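/- arXiv:1401.6418 — 2 statements merged into one kernel-verified Lean document; each statement's English description precedes it below -/
import Mathlib

section
/- For integers 0 ≤ m ≤ n, the domain Δ_n^m = {X ⊆ [n] : |X| = m} (the discrete Grassmannian) is w-pure, and its w-rank equals m(n−m) + 1. -/
open Finset

/-- max of a finite set of naturals, with the convention `max0 ∅ = 0`. -/
def max0 (A : Finset ℕ) : ℕ := if h : A.Nonempty then A.max' h else 0

/-- min of a finite set of naturals, with the convention `min0 ∅ = 0`. -/
def min0 (A : Finset ℕ) : ℕ := if h : A.Nonempty then A.min' h else 0

/-- `A < B` : global dominating, i.e. `max A < min B` (with `min ∅ = max ∅ = 0`). -/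
def SetLT (A B : Finset ℕ) : Prop := max0 A < min0 B

/-- `A ⋖ B` : global dominating after cancelations, i.e. `(A − B) < (B − A)`. -/
def LessDot (A B : Finset ℕ) : Prop := SetLT (A \ B) (B \ A)

/-- `A ▷ B` (splitting): `A − B ≠ ∅` and `B − A` is a union of nonempty subsets
`B′, B″` with `B′ < (A − B) < B″`. -/
def Splits (A B : Finset ℕ) : Prop :=
  (A \ B).Nonempty ∧ ∃ B' B'' : Finset ℕ, B'.Nonempty ∧ B''.Nonempty ∧
    B' ∪ B'' = B \ A ∧ SetLT B' (A \ B) ∧ SetLT (A \ B) B''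

/-- `A` and `B` are strongly separated. -/
def StronglySep (A B : Finset ℕ) : Prop := LessDot A B ∨ LessDot B A ∨ A = B

/-- `A` and `B` are weakly separated. -/
def WeaklySep (A B : Finset ℕ) : Prop :=
  StronglySep A B ∨ (Splits A B ∧ B.card ≤ A.card) ∨ (Splits B A ∧ A.card ≤ B.card)

/-- a w-collection: members are pairwise weakly separated. -/
def IsWColl (F : Finset (Finset ℕ)) : Prop := ∀ A ∈ F, ∀ B ∈ F, WeaklySep A B

/-- a maximal w-collection in the domain `D`. -/
def IsMaxWColl (D : Set (Finset ℕ)) (F : Finset (Finset ℕ)) : Prop :=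
  ↑F ⊆ D ∧ IsWColl F ∧
    ∀ G : Finset (Finset ℕ), ↑G ⊆ D → IsWColl G → F ⊆ G → F = G

/-- the domain `D` is w-pure: all maximal w-collections in `D` have the same cardinality. -/
def WPure (D : Set (Finset ℕ)) : Prop :=
  ∀ F G : Finset (Finset ℕ), IsMaxWColl D F → IsMaxWColl D G → F.card = G.card

/-- an s-collection: members are pairwise strongly separated. -/
def IsSColl (F : Finset (Finset ℕ)) : Prop := ∀ A ∈ F, ∀ B ∈ F, StronglySep A B

/-- a maximal s-collection in the domain `D`. -/
def IsMaxSColl (D : Set (Finset ℕ)) (F : Finset (Finset ℕ)) : Prop :=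
  ↑F ⊆ D ∧ IsSColl F ∧
    ∀ G : Finset (Finset ℕ), ↑G ⊆ D → IsSColl G → F ⊆ G → F = G

/-- the domain `D` is s-pure: all maximal s-collections in `D` have the same cardinality. -/
def SPure (D : Set (Finset ℕ)) : Prop :=
  ∀ F G : Finset (Finset ℕ), IsMaxSColl D F → IsMaxSColl D G → F.card = G.card


section Separation

variable {α : Type*} [LinearOrder α]

/-- Every element of `A \ B` is smaller than every element of `B \ A`. -/
def Precedes (A B : Finset α) : Prop :=
  ∀ p q, p ∈ A → p ∉ B → q ∈ B → q ∉ A → p < q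

/-- No element of `B \ A` lies between two elements of `A \ B`. -/
def NoAlt3 (A B : Finset α) : Prop :=
  ∀ x y z, x ∈ A → x ∉ B → y ∈ B → y ∉ A → z ∈ A → z ∉ B → x < y → ¬ y < z

/-- No chain of length four alternates between `A \ B` and `B \ A`, starting in `A \ B`. -/
def NoAlt4 (A B : Finset α) : Prop :=
  ∀ x y z w, x ∈ A → x ∉ B → y ∈ B → y ∉ A → z ∈ A → z ∉ B → w ∈ B → w ∉ A →
    x < y → y < z → ¬ z < w

/-- Weak separation, expressed by forbidden alternating chains. -/
def WS (A B : Finset α) : Prop :=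
  (B.card < A.card → NoAlt3 A B) ∧ (A.card < B.card → NoAlt3 B A) ∧
    (A.card = B.card → NoAlt4 A B ∧ NoAlt4 B A)

theorem WS.symm {A B : Finset α} (h : WS A B) : WS B A :=
  ⟨h.2.1, h.1, fun e => (h.2.2 e.symm).symm⟩

theorem WS.refl (A : Finset α) : WS A A :=
  ⟨fun h => absurd h (lt_irrefl _), fun h => absurd h (lt_irrefl _),
    fun _ => ⟨fun _ _ _ _ h h' => absurd h h', fun _ _ _ _ h h' => absurd h h'⟩⟩

theorem Precedes.noAlt3 {A B : Finset α} (h : Precedes A B) : NoAlt3 A B ∧ NoAlt3 B A := by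
  unfold Precedes NoAlt3 at *
  exact ⟨fun x y z hx hx' hy hy' hz hz' _ h2 => lt_asymm h2 (h z y hz hz' hy hy'),
    fun x y z hx hx' hy hy' hz hz' h1 _ => lt_asymm h1 (h y x hy hy' hx hx')⟩

theorem NoAlt3.noAlt4 {A B : Finset α} (h : NoAlt3 A B) : NoAlt4 A B ∧ NoAlt4 B A :=
  ⟨fun x y z _ hx hx' hy hy' hz hz' _ _ h1 h2 _ => h x y z hx hx' hy hy' hz hz' h1 h2,
    fun _ y z w _ _ hy hy' hz hz' hw hw' _ h2 h3 => h y z w hy hy' hz hz' hw hw' h2 h3⟩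

theorem Precedes.ws {A B : Finset α} (h : Precedes A B) : WS A B :=
  ⟨fun _ => h.noAlt3.1, fun _ => h.noAlt3.2, fun _ => h.noAlt3.1.noAlt4⟩

theorem exists_mem_notMem_of_card {X Y : Finset α} (h : X.card ≤ Y.card) {p : α} (hp : p ∈ X)
    (hpY : p ∉ Y) : ∃ q ∈ Y, q ∉ X := by
  by_contra! hc
  have : Y ⊂ X := ⟨hc, fun h' => hpY (h' hp)⟩
  exact absurd (card_lt_card this) (by omega)

variable {X Y : Finset α} {n a : α}

theorem ws_insert_max_iff (hX : ∀ x ∈ X, x < n) (hY : ∀ y ∈ Y, y < n)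
    (h : WS X Y) : WS X (insert n Y) ↔ (X.card ≤ Y.card → Precedes X Y) := by
  have hnX : n ∉ X := fun h => lt_irrefl _ (hX n h)
  have hnY : n ∉ Y := fun h => lt_irrefl _ (hY n h)
  obtain ⟨h1, h2, h3⟩ := h
  rw [WS, card_insert_of_notMem hnY]
  constructor
  · rintro ⟨-, k, -⟩ hc
    have k := k (by omega)
    unfold NoAlt3 Precedes at *
    clear h1 h2 h3
    intro p q
    have := k q p n
    grind
  · intro k
    refine ⟨fun hc => ?_, fun hc => ?_, fun hc => ?_⟩
    · have h1 := h1 (by omega)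
      clear k h2 h3
      unfold NoAlt3 at *
      grind
    · have k := k (by omega)
      clear h1 h2 h3
      intro x y z
      have := k y x
      grind
    · have h1 := h1 (by omega)
      have h4 := h1.noAlt4
      clear k h2 h3
      unfold NoAlt3 NoAlt4 at *
      constructor
      · intro x y z w
        have := h1 x y z
        clear h1 h4
        grind
      · intro x y z w
        have := h4.2 x y z w
        clear h1 h4
        grind

theorem ws_insert_min_iff (hX : ∀ x ∈ X, a < x) (hY : ∀ y ∈ Y, a < y)
    (h : WS X Y) : WS X (insert a Y) ↔ (X.card ≤ Y.card → Precedes Y X) := by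
  have hnX : a ∉ X := fun h => lt_irrefl _ (hX a h)
  have hnY : a ∉ Y := fun h => lt_irrefl _ (hY a h)
  obtain ⟨h1, h2, h3⟩ := h
  rw [WS, card_insert_of_notMem hnY]
  constructor
  · rintro ⟨-, k, -⟩ hc
    have k := k (by omega)
    unfold NoAlt3 Precedes at *
    clear h1 h2 h3
    intro p q
    have := k a q p
    grind
  · intro k
    refine ⟨fun hc => ?_, fun hc => ?_, fun hc => ?_⟩
    · have h1 := h1 (by omega)
      clear k h2 h3
      unfold NoAlt3 at *
      grind
    · have k := k (by omega)
      clear h1 h2 h3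
      intro x y z
      have := k z y
      grind
    · have h1 := h1 (by omega)
      have h4 := h1.noAlt4
      clear k h2 h3
      unfold NoAlt3 NoAlt4 at *
      constructor
      · intro x y z w
        have := h4.1 x y z w
        clear h1 h4
        grind
      · intro x y z w
        have := h1 y z w
        clear h1 h4
        grind

theorem ws_insert_insert_iff (hX : n ∉ X) (hY : n ∉ Y) :
    WS (insert n X) (insert n Y) ↔ WS X Y := by
  have e3 : ∀ {X Y : Finset α}, n ∉ X → n ∉ Y →
      (NoAlt3 (insert n X) (insert n Y) ↔ NoAlt3 X Y) := by
    intro X Y hX hY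
    unfold NoAlt3
    refine forall₃_congr fun x y z => ?_
    grind
  have e4 : ∀ {X Y : Finset α}, n ∉ X → n ∉ Y →
      (NoAlt4 (insert n X) (insert n Y) ↔ NoAlt4 X Y) := by
    intro X Y hX hY
    unfold NoAlt4
    refine forall₄_congr fun x y z w => ?_
    grind
  simp only [WS, card_insert_of_notMem hX, card_insert_of_notMem hY, e3 hX hY, e3 hY hX, e4 hX hY,
    e4 hY hX, add_lt_add_iff_right, add_left_inj]

/-- Deleting the largest element preserves weak separation. -/
theorem WS.of_insert_max (hX : ∀ x ∈ X, x < n) (hY : ∀ y ∈ Y, y < n)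
    (h : WS X (insert n Y)) : WS X Y := by
  have hnX : n ∉ X := fun h => lt_irrefl _ (hX n h)
  have hnY : n ∉ Y := fun h => lt_irrefl _ (hY n h)
  rw [WS, card_insert_of_notMem hnY] at h
  obtain ⟨h1, h2, h3⟩ := h
  have hP : #X ≤ #Y → Precedes X Y := fun hc p q => by
    have := h2 (by omega) q p n
    clear h1 h2 h3
    grind
  refine ⟨fun hc => ?_, fun hc => (hP hc.le).noAlt3.2, fun hc => (hP hc.le).ws.2.2 hc⟩
  intro x y z
  rcases lt_or_eq_of_le (Nat.succ_le_of_lt hc) with hc | hc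
  · have := h1 hc x y z
    clear h1 h2 h3
    grind
  · have := (h3 hc.symm).1 x y z n
    clear h1 h2 h3
    grind

/-- Deleting the smallest element preserves weak separation. -/
theorem WS.of_insert_min (hX : ∀ x ∈ X, a < x) (hY : ∀ y ∈ Y, a < y)
    (h : WS X (insert a Y)) : WS X Y := by
  have hnX : a ∉ X := fun h => lt_irrefl _ (hX a h)
  have hnY : a ∉ Y := fun h => lt_irrefl _ (hY a h)
  rw [WS, card_insert_of_notMem hnY] at h
  obtain ⟨h1, h2, h3⟩ := h
  have hP : #X ≤ #Y → Precedes Y X := fun hc p q => by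
    have := h2 (by omega) a q p
    clear h1 h2 h3
    grind
  refine ⟨fun hc => ?_, fun hc => (hP hc.le).noAlt3.1, fun hc => (hP hc.le).ws.symm.2.2 hc⟩
  intro x y z
  rcases lt_or_eq_of_le (Nat.succ_le_of_lt hc) with hc | hc
  · have := h1 hc x y z
    clear h1 h2 h3
    grind
  · have := (h3 hc.symm).2 a x y z
    clear h1 h2 h3
    grind

/-- Complementation preserves weak separation. -/
theorem WS.compl {T : Finset α} (hX : X ⊆ T) (hY : Y ⊆ T) (h : WS X Y) : WS (T \ X) (T \ Y) := by
  have e3 : ∀ {X Y : Finset α}, X ⊆ T → Y ⊆ T → NoAlt3 X Y → NoAlt3 (T \ Y) (T \ X) := by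
    intro X Y hX hY h x y z
    have := h x y z
    have := @hX y
    have := @hY x
    have := @hY z
    clear h hX hY
    grind
  have e4 : ∀ {X Y : Finset α}, X ⊆ T → Y ⊆ T → NoAlt4 X Y → NoAlt4 (T \ Y) (T \ X) := by
    intro X Y hX hY h x y z w
    have := h x y z w
    have := @hX y
    have := @hY x
    have := @hY z
    have := @hX w
    clear h hX hY
    grind
  have cX := card_sdiff_add_card_eq_card hX
  have cY := card_sdiff_add_card_eq_card hY
  exact ⟨fun hc => e3 hY hX (h.2.1 (by omega)), fun hc => e3 hX hY (h.1 (by omega)),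
    fun hc => ⟨e4 hY hX (h.2.2 (by omega)).2, e4 hX hY (h.2.2 (by omega)).1⟩⟩

theorem exists_mem_notMem_of_card_lt {X Y : Finset α} (h : #X < #Y) : ∃ q ∈ Y, q ∉ X := by
  by_contra! hc
  exact absurd (card_le_card (show Y ⊆ X from hc)) (by omega)

theorem not_precedes_iff {A B : Finset α} :
    ¬ Precedes A B ↔ ∃ p q, q < p ∧ p ∈ A ∧ p ∉ B ∧ q ∈ B ∧ q ∉ A := by
  unfold Precedes
  push Not
  refine exists₂_congr fun p q => ⟨fun ⟨h1, h2, h3, h4, h5⟩ => ⟨h5.lt_of_ne ?_, h1, h2, h3, h4⟩,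
    fun ⟨h5, h1, h2, h3, h4⟩ => ⟨h1, h2, h3, h4, h5.le⟩⟩
  rintro rfl
  exact h2 h3

/-- A set with one element more than `A` either contains `A` or omits one of its elements. -/
theorem exists_notMem_or_insert {A B : Finset α} (h : #B = #A + 1) :
    (∃ c ∈ A, c ∉ B) ∨ ∃ b, ∀ x, x ∈ B ↔ x ∈ A ∨ x = b := by
  by_cases hs : A ⊆ B
  · obtain ⟨b, -, rfl⟩ := exists_eq_insert_iff.2 ⟨hs, h.symm⟩
    exact Or.inr ⟨b, fun x => by rw [mem_insert, or_comm]⟩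
  · exact Or.inl (by simpa [not_subset] using hs)

theorem exists_mem_notMem_of_ne {X Y : Finset α} (h : #X ≤ #Y) (hne : X ≠ Y) :
    ∃ q ∈ Y, q ∉ X := by
  by_contra! hc
  exact hne (eq_of_subset_of_card_le (show Y ⊆ X from hc) h).symm

section Chain

variable {A B X W : Finset α}

theorem chain_out_out (hAB' : (∃ c ∈ A, c ∉ B) ∨ ∃ b, ∀ x, x ∈ B ↔ x ∈ A ∨ x = b)
    (hAB : Precedes A B) (hXA : Precedes X A) (hXB : Precedes X B) (hWB : NoAlt3 W B)
    (hWA : NoAlt3 W A) (hXW : ∃ w ∈ W, w ∉ X) (h1 : ∃ p ∈ X, p ∉ A) (h2 : ¬ Precedes W B) :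
    ¬ Precedes W X := by
  obtain ⟨s, t, h2⟩ := not_precedes_iff.1 h2
  obtain ⟨w, hw⟩ := hXW
  obtain ⟨p, hp⟩ := h1
  intro hWX
  rcases hAB' with ⟨c, hc⟩ | ⟨b, hb⟩
  · have := hWB c t s
    have := hWB w t s
    have := hWB p t s
    have := hWX w t
    have := hAB c t
    have := hWX s p
    have := hXA p c
    have := hWX s t
    have := hXB s t
    have := hAB c p
    have := hXA p t
    have := hWX s c
    have := hXB s w
    clear hWB hWA hWX hXA hXB hAB
    grind (splits := 40) (splitImp := true)
  · have := hWB w t s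
    have := hWB p b s
    have := hWA p t s
    have := hXB p b
    have := hWX w t
    have := hWX w p
    have := hXA p w
    have := hXA p t
    clear hWB hWA hWX hXA hXB hAB
    grind (splits := 40) (splitImp := true)

theorem chain_out_out_of_card_eq (hXB : Precedes X B) (hWB : NoAlt3 W B)
    (hXW : ∃ w ∈ W, w ∉ X) (h1 : ∃ p ∈ X, p ∉ B) (h2 : ¬ Precedes W B) : ¬ Precedes W X := by
  obtain ⟨s, t, h2⟩ := not_precedes_iff.1 h2
  obtain ⟨w, hw⟩ := hXW
  obtain ⟨d, hd⟩ := h1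
  intro hWX
  have := hWB w t s
  have := hWB d t s
  have := hWX w d
  have := hXB d w
  have := hWX w t
  have := hXB d t
  clear hWB hWX hXB
  grind (splits := 40) (splitImp := true)

theorem chain_in_out (hAB' : (∃ c ∈ A, c ∉ B) ∨ ∃ b, ∀ x, x ∈ B ↔ x ∈ A ∨ x = b)
    (hAB : Precedes A B) (hAX : NoAlt3 A X) (hBX : NoAlt3 B X)
    (hWA : NoAlt3 W A) (hWB : NoAlt3 W B) (hXW : ∃ w ∈ W, w ∉ X) (h1 : ¬ Precedes A X)
    (h2 : ¬ Precedes W B) : ¬ Precedes W X := by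
  obtain ⟨p, q, h1⟩ := not_precedes_iff.1 h1
  obtain ⟨s, t, h2⟩ := not_precedes_iff.1 h2
  obtain ⟨w, hw⟩ := hXW
  intro hWX
  rcases hAB' with ⟨c, hc⟩ | ⟨b, hb⟩
  · have := hWB q t s
    have := hAX t q p
    have := hAX c q p
    have := hWB w t s
    have := hWB c t s
    have := hAX w q p
    have := hWX w t
    have := hAB c t
    have := hAB c q
    have := hAB c w
    have := hWX w q
    have := hWX w c
    clear hAX hBX hAB hWA hWB hWX
    grind (splits := 40) (splitImp := true)
  · have := hWA q t s
    have := hWB w t s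
    have := hAX w q p
    have := hAX t q p
    have := hWB q b s
    have := hBX b q p
    have := hWX w q
    have := hWX w t
    clear hAX hBX hAB hWA hWB hWX
    grind (splits := 40) (splitImp := true)

theorem chain_in_in (hAB' : (∃ c ∈ A, c ∉ B) ∨ ∃ b, ∀ x, x ∈ B ↔ x ∈ A ∨ x = b)
    (hAB : Precedes A B) (hAX : NoAlt3 A X) (hBX : NoAlt3 B X) (hWX' : NoAlt3 W X)
    (hAW : Precedes A W) (hBW : Precedes B W) (hXW : ∃ w ∈ W, w ∉ X) (h1 : ¬ Precedes A X)
    (h2 : ∃ g ∈ B, g ∉ W) : ¬ Precedes W X := by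
  obtain ⟨p, q, h1⟩ := not_precedes_iff.1 h1
  obtain ⟨g, hg⟩ := h2
  obtain ⟨w, hw⟩ := hXW
  intro hWX
  rcases hAB' with ⟨c, hc⟩ | ⟨b, hb⟩
  · have := hAX g q p
    have := hAX c q p
    have := hAX w q p
    have := hWX' w q p
    have := hWX w q
    have := hWX p g
    have := hAB c g
    have := hBW g q
    have := hBW g c
    have := hAB c q
    have := hWX p c
    have := hAW p q
    have := hAW p w
    clear hAX hBX hWX' hAB hAW hBW hWX
    grind (splits := 40) (splitImp := true)
  · have := hBX g q p
    have := hAX w q p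
    have := hAX g b p
    have := hWX w q
    have := hWX w g
    have := hBW g w
    have := hAW g w
    have := hAW g q
    have := hBW g q
    clear hAX hBX hWX' hAB hAW hBW hWX
    grind (splits := 40) (splitImp := true)

theorem chain_in_in_of_card_eq (hAX : NoAlt3 A X) (hAW : Precedes A W) (hXW : ∃ w ∈ W, w ∉ X)
    (hAW' : ∃ f ∈ A, f ∉ W) (h1 : ¬ Precedes A X) : ¬ Precedes W X := by
  obtain ⟨p, q, h1⟩ := not_precedes_iff.1 h1
  obtain ⟨f, hf⟩ := hAW'
  obtain ⟨w, hw⟩ := hXW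
  intro hWX
  have := hAX f q p
  have := hAX w q p
  have := hWX w q
  have := hWX w f
  have := hAW f w
  have := hAW f q
  clear hAX hAW hWX
  grind (splits := 40) (splitImp := true)

theorem chain_out_in (hAB' : (∃ c ∈ A, c ∉ B) ∨ ∃ b, ∀ x, x ∈ B ↔ x ∈ A ∨ x = b)
    (hAB : Precedes A B) (hXA : Precedes X A) (hXB : Precedes X B)
    (hAW : Precedes A W) (hBW : Precedes B W) (h1 : ∃ p ∈ X, p ∉ A)
    (h2 : ∃ g ∈ B, g ∉ W) : ∃ p ∈ X, p ∉ W := by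
  obtain ⟨p, hp⟩ := h1
  obtain ⟨g, hg⟩ := h2
  by_contra! hXW
  have := hXW p
  have := hXW g
  rcases hAB' with ⟨c, hc⟩ | ⟨b, hb⟩
  · have := hXW c
    have := hAW g p
    have := hBW g c
    have := hXA p c
    have := hXA p g
    have := hAW c p
    have := hAB c g
    clear hXA hXB hAB hAW hBW hXW
    grind (splits := 40) (splitImp := true)
  · have := hBW g p
    have := hAW g p
    have := hXA p g
    have := hXB p g
    clear hXA hXB hAB hAW hBW hXW
    grind (splits := 40) (splitImp := true)

theorem chain_out_in_of_precedes (hXB : Precedes X B) (hBW : Precedes B W) (h1 : ∃ p ∈ X, p ∉ B)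
    (h2 : ∃ g ∈ B, g ∉ W) : ∃ p ∈ X, p ∉ W := by
  obtain ⟨p, hp⟩ := h1
  obtain ⟨g, hg⟩ := h2
  by_contra! hXW
  have := hXW p
  have := hXW g
  have := hBW g p
  have := hXB p g
  clear hXB hBW hXW
  grind (splits := 40) (splitImp := true)

end Chain

theorem exists_insert_of_mem {X : Finset α} {n : α} (hX : ∀ x ∈ X, x ≤ n) (h : n ∈ X) :
    ∃ X', (∀ x ∈ X', x < n) ∧ #X = #X' + 1 ∧ X = insert n X' :=
  ⟨X.erase n, fun x hx => (hX x (mem_of_mem_erase hx)).lt_of_ne (ne_of_mem_erase hx),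
    (card_erase_add_one h).symm, (insert_erase h).symm⟩

theorem WS.precedes_of_eq {A B : Finset α} {n : α} (hA : ∀ x ∈ A, x < n) (hB : ∀ x ∈ B, x < n)
    (h : WS A (insert n B)) (hc : #A ≤ #B) : Precedes A B :=
  (ws_insert_max_iff hA hB (h.of_insert_max hA hB)).1 h hc

/-- The relation `#X ≤ #Y ∧ ¬ Precedes Y X` between sets `X` and `Y` can be chained
through a pair of consecutive sets `A`, `B` that stay separated after adding a new maximum. -/
theorem WS.chain {A B X W : Finset α} {n : α} (hA : ∀ x ∈ A, x < n) (hB : ∀ x ∈ B, x < n)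
    (hX : ∀ x ∈ X, x ≤ n) (hW : ∀ x ∈ W, x ≤ n) (hc : #B = #A + 1)
    (hAB : Precedes A B) (XA : WS X A) (XAn : WS X (insert n A)) (XB : WS X B)
    (XBn : WS X (insert n B)) (WA : WS W A) (WAn : WS W (insert n A)) (WB : WS W B)
    (WBn : WS W (insert n B)) (XW : WS X W)
    (h1 : (#X ≤ #A ∧ ¬ Precedes A X) ∨ (#X ≤ #A + 1 ∧ ¬ Precedes (insert n A) X))
    (h2 : (#B ≤ #W ∧ ¬ Precedes W B) ∨ (#B + 1 ≤ #W ∧ ¬ Precedes W (insert n B))) :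
    #X ≤ #W ∧ ¬ Precedes W X := by
  have hAB' := exists_notMem_or_insert hc
  simp only [not_precedes_iff] at h1 h2
  have hnA : n ∉ A := fun h => lt_irrefl _ (hA n h)
  have hnB : n ∉ B := fun h => lt_irrefl _ (hB n h)
  by_cases hnW : n ∈ W
  · obtain ⟨W, hW', cW, rfl⟩ := exists_insert_of_mem hW hnW
    have hnW' : n ∉ W := fun h => lt_irrefl _ (hW' n h)
    have AW : #A ≤ #W → Precedes A W := WS.precedes_of_eq hA hW' WA.symm
    have BW : #B ≤ #W → Precedes B W := WS.precedes_of_eq hB hW' WB.symm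
    obtain ⟨cBW, h2⟩ : #B ≤ #W + 1 ∧ ∃ g ∈ B, g ∉ W := by
      rw [cW] at h2
      rcases h2 with ⟨h, p, q, hpq, hp, hp', hq, hq'⟩ | ⟨h, p, q, hpq, hp, hp', hq, hq'⟩
      · exact ⟨h, q, hq, by grind⟩
      · exact ⟨by omega, q, by grind, by grind⟩
    have cAW : #A ≤ #W := by omega
    have AW := AW cAW
    by_cases hnX : n ∈ X
    · obtain ⟨X, hX', cX, rfl⟩ := exists_insert_of_mem hX hnX
      have hnX' : n ∉ X := fun h => lt_irrefl _ (hX' n h)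
      have AX : #A ≤ #X → Precedes A X := WS.precedes_of_eq hA hX' XA.symm
      obtain ⟨cXA, h1⟩ : #X ≤ #A ∧ ¬ Precedes A X := by
        rw [cX] at h1
        rw [not_precedes_iff]
        rcases h1 with ⟨h, p, q, hpq, hp, hp', hq, hq'⟩ | ⟨h, p, q, hpq, hp, hp', hq, hq'⟩
        · exact ⟨by omega, p, q, hpq, hp, by grind, by grind, hq'⟩
        · exact ⟨by omega, p, q, hpq, by grind, by grind, by grind, by grind⟩
      have cXA : #X < #A := by
        by_contra hcc
        exact h1 (AX (by omega))
      have XA := XA.symm.of_insert_max hA hX'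
      have XB := XB.symm.of_insert_max hB hX'
      have XW := (ws_insert_insert_iff hnX' hnW').1 XW
      refine ⟨by omega, ?_⟩
      suffices ¬ Precedes W X by
        rw [not_precedes_iff] at this ⊢
        obtain ⟨p, q, hpq, hp, hp', hq, hq'⟩ := this
        exact ⟨p, q, hpq, by grind, by grind, by grind, by grind⟩
      have hXW := exists_mem_notMem_of_card_lt (show #X < #W by omega)
      by_cases hcb : #B ≤ #W
      · exact chain_in_in hAB' hAB (XA.1 (by omega)) (XB.1 (by omega)) (XW.2.1 (by omega)) AW
          (BW hcb) hXW h1 h2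
      · by_cases e : A ⊆ W
        · rwa [← eq_of_subset_of_card_le e (by omega)]
        · exact chain_in_in_of_card_eq (XA.1 (by omega)) AW hXW (by simpa [not_subset] using e) h1
    · have hX' : ∀ x ∈ X, x < n := fun x hx => (hX x hx).lt_of_ne fun e => hnX (e ▸ hx)
      obtain ⟨cXA, h1⟩ : #X ≤ #A + 1 ∧ ∃ p ∈ X, p ∉ A := by
        rcases h1 with ⟨h, p, q, hpq, hp, hp', hq, hq'⟩ | ⟨h, p, q, hpq, hp, hp', hq, hq'⟩
        · exact ⟨by omega, q, hq, hq'⟩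
        · exact ⟨by omega, q, hq, by grind⟩
      have XA' := WS.precedes_of_eq hX' hA XAn
      have XB' := WS.precedes_of_eq hX' hB XBn (by omega)
      suffices ∃ p ∈ X, p ∉ W by
        obtain ⟨p, hp, hp'⟩ := this
        refine ⟨by omega, not_precedes_iff.2 ⟨n, p, hX' p hp, by grind, hnX, hp, ?_⟩⟩
        have := hX' p hp
        grind
      by_cases hcb : #B ≤ #W
      · by_cases hcx : #X ≤ #A
        · exact chain_out_in hAB' hAB (XA' hcx) XB' AW (BW hcb) h1 h2
        · by_cases e : X ⊆ B
          · rwa [eq_of_subset_of_card_le e (by omega)]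
          · exact chain_out_in_of_precedes XB' (BW hcb) (by simpa [not_subset] using e) h2
      · by_cases hcx : #X ≤ #A
        · by_cases e : A ⊆ W
          · rwa [← eq_of_subset_of_card_le e (by omega)]
          · exact chain_out_in_of_precedes (XA' hcx) AW h1 (by simpa [not_subset] using e)
        · exact exists_mem_notMem_of_card_lt (by omega)
  · have hW' : ∀ x ∈ W, x < n := fun x hx => (hW x hx).lt_of_ne fun e => hnW (e ▸ hx)
    have WB' := WS.precedes_of_eq hW' hB WBn
    obtain ⟨cBW, h2⟩ : #B ≤ #W ∧ ¬ Precedes W B := by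
      rw [not_precedes_iff]
      rcases h2 with ⟨h, p, q, hpq, hp, hp', hq, hq'⟩ | ⟨h, p, q, hpq, hp, hp', hq, hq'⟩
      · exact ⟨h, p, q, hpq, hp, hp', hq, hq'⟩
      · have := hW' p hp
        exact ⟨by omega, p, q, hpq, hp, by grind, by grind, hq'⟩
    have cBW : #B < #W := by
      by_contra hcc
      exact h2 (WB' (by omega))
    by_cases hnX : n ∈ X
    · obtain ⟨X, hX', cX, rfl⟩ := exists_insert_of_mem hX hnX
      have hnX' : n ∉ X := fun h => lt_irrefl _ (hX' n h)
      have AX : #A ≤ #X → Precedes A X := WS.precedes_of_eq hA hX' XA.symm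
      obtain ⟨cXA, h1⟩ : #X ≤ #A ∧ ¬ Precedes A X := by
        rw [cX] at h1
        rw [not_precedes_iff]
        rcases h1 with ⟨h, p, q, hpq, hp, hp', hq, hq'⟩ | ⟨h, p, q, hpq, hp, hp', hq, hq'⟩
        · exact ⟨by omega, p, q, hpq, hp, by grind, by grind, hq'⟩
        · exact ⟨by omega, p, q, hpq, by grind, by grind, by grind, by grind⟩
      have cXA : #X < #A := by
        by_contra hcc
        exact h1 (AX (by omega))
      have XA := XA.symm.of_insert_max hA hX'
      have XB := XB.symm.of_insert_max hB hX'
      refine ⟨by omega, ?_⟩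
      suffices ¬ Precedes W X by
        rw [not_precedes_iff] at this ⊢
        obtain ⟨p, q, hpq, hp, hp', hq, hq'⟩ := this
        have := hW' p hp
        exact ⟨p, q, hpq, by grind, by grind, by grind, by grind⟩
      exact chain_in_out hAB' hAB (XA.1 (by omega)) (XB.1 (by omega)) (WA.1 (by omega))
        (WB.1 (by omega)) (exists_mem_notMem_of_card_lt (by omega)) h1 h2
    · have hX' : ∀ x ∈ X, x < n := fun x hx => (hX x hx).lt_of_ne fun e => hnX (e ▸ hx)
      obtain ⟨cXA, h1⟩ : #X ≤ #A + 1 ∧ ∃ p ∈ X, p ∉ A := by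
        rcases h1 with ⟨h, p, q, hpq, hp, hp', hq, hq'⟩ | ⟨h, p, q, hpq, hp, hp', hq, hq'⟩
        · exact ⟨by omega, q, hq, hq'⟩
        · exact ⟨by omega, q, hq, by grind⟩
      have XA' := WS.precedes_of_eq hX' hA XAn
      have XB' := WS.precedes_of_eq hX' hB XBn (by omega)
      refine ⟨by omega, ?_⟩
      have hXW := exists_mem_notMem_of_card_lt (show #X < #W by omega)
      by_cases hcx : #X ≤ #A
      · exact chain_out_out hAB' hAB (XA' hcx) XB' (WB.1 (by omega)) (WA.1 (by omega)) hXW h1 h2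
      · by_cases e : X ⊆ B
        · rwa [eq_of_subset_of_card_le e (by omega)]
        · exact chain_out_out_of_card_eq XB' (WB.1 (by omega)) hXW
            (by simpa [not_subset] using e) h2

/-- The sets avoiding `a` that lie in `F`, possibly after inserting `a`. -/
def deletion (a : α) (F : Set (Finset α)) : Set (Finset α) :=
  {X | a ∉ X ∧ (X ∈ F ∨ insert a X ∈ F)}

theorem deletion_subset {a : α} {T : Finset α} {F : Set (Finset α)}
    (hF : ∀ X ∈ F, X ⊆ insert a T) {X : Finset α} (hX : X ∈ deletion a F) : X ⊆ T := by
  rcases hX with ⟨ha, h | h⟩ <;> intro x hx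
  · exact (mem_insert.1 (hF X h hx)).resolve_left fun e => ha (e ▸ hx)
  · exact (mem_insert.1 (hF _ h (mem_insert_of_mem hx))).resolve_left fun e => ha (e ▸ hx)

theorem mem_deletion_or {a : α} {F : Set (Finset α)} {X : Finset α} (hX : X ∈ F) :
    (a ∉ X ∧ X ∈ deletion a F) ∨ ∃ X' ∈ deletion a F, X = insert a X' := by
  by_cases h : a ∈ X
  · exact Or.inr ⟨X.erase a, ⟨notMem_erase a X, Or.inr (by rwa [insert_erase h])⟩,
      (insert_erase h).symm⟩
  · exact Or.inl ⟨h, h, Or.inl hX⟩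

theorem ws_deletion_min {a : α} {T : Finset α} (ha : ∀ x ∈ T, a < x) {F : Set (Finset α)}
    (hF : ∀ X ∈ F, X ⊆ insert a T) (hW : ∀ X ∈ F, ∀ Y ∈ F, WS X Y) :
    ∀ X ∈ deletion a F, ∀ Y ∈ deletion a F, WS X Y := by
  intro X hX Y hY
  have hX' : ∀ x ∈ X, a < x := fun x hx => ha x (deletion_subset hF hX hx)
  have hY' : ∀ x ∈ Y, a < x := fun x hx => ha x (deletion_subset hF hY hx)
  obtain ⟨haX, hX | hX⟩ := hX <;> obtain ⟨haY, hY | hY⟩ := hY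
  · exact hW _ hX _ hY
  · exact (hW _ hX _ hY).of_insert_min hX' hY'
  · exact ((hW _ hX _ hY).symm.of_insert_min hY' hX').symm
  · exact (ws_insert_insert_iff haX haY).1 (hW _ hX _ hY)

/-- For every cardinality there is a set that is weakly separated from the whole collection,
both with and without the maximal element. -/
theorem exists_ws_and_ws_insert {n : α} (T : Finset α) : (∀ t ∈ T, t < n) →
    ∀ F : Set (Finset α), (∀ X ∈ F, X ⊆ insert n T) → (∀ X ∈ F, ∀ Y ∈ F, WS X Y) →
    ∀ i ≤ #T, ∃ K ⊆ T, #K = i ∧ ∀ X ∈ F, WS X K ∧ WS X (insert n K) := by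
  have h0 : ∀ T : Finset α, (∀ t ∈ T, t < n) → ∀ X ⊆ insert n T, WS X ∅ ∧ WS X (insert n ∅) := by
    intro T hT X hX
    refine ⟨Precedes.ws fun p q _ _ hq _ => absurd hq (notMem_empty q), Precedes.ws ?_⟩
    intro p q hp hp' hq hq'
    have := hT p
    have := hX hp
    clear hT hX
    grind
  have h1 : ∀ T : Finset α, (∀ t ∈ T, t < n) → ∀ X ⊆ insert n T, WS X T ∧ WS X (insert n T) := by
    intro T hT X hX
    refine ⟨WS.symm (Precedes.ws ?_), Precedes.ws fun p q hp hp' => absurd (hX hp) hp'⟩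
    intro p q hp hp' hq hq'
    have := hT p
    have := hX hq
    clear hT hX
    grind
  induction T using Finset.induction_on_min with
  | empty =>
    intro hT F hF _ i hi
    obtain rfl : i = 0 := by simpa using hi
    exact ⟨∅, subset_rfl, rfl, fun X hX => h0 _ hT X (hF X hX)⟩
  | insert a T ha IH =>
    intro hT F hF hW i hi
    have haT : a ∉ T := fun h => lt_irrefl _ (ha a h)
    rw [card_insert_of_notMem haT] at hi
    rcases Nat.eq_zero_or_pos i with rfl | hi0
    · exact ⟨∅, empty_subset _, rfl, fun X hX => h0 _ hT X (hF X hX)⟩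
    rcases hi.eq_or_lt with rfl | hi
    · exact ⟨insert a T, subset_rfl, card_insert_of_notMem haT, fun X hX => h1 _ hT X (hF X hX)⟩
    have han : a < n := hT a (mem_insert_self a T)
    have hT' : ∀ t ∈ T, t < n := fun t ht => hT t (mem_insert_of_mem ht)
    have ha' : ∀ x ∈ insert n T, a < x := by
      intro x hx
      rcases mem_insert.1 hx with rfl | hx
      exacts [han, ha x hx]
    rw [insert_comm] at hF
    have hHs : ∀ X ∈ deletion a F, X ⊆ insert n T := fun X => deletion_subset hF
    have hHW := ws_deletion_min ha' hF hW
    obtain ⟨B, hBT, hBi, hB⟩ := IH hT' _ hHs hHW i (by omega)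
    have hnB : n ∉ B := fun h => lt_irrefl _ (hT' n (hBT h))
    have hBn : WS B (insert n B) := Precedes.ws fun p q hp hp' =>
      absurd (mem_insert_of_mem hp) hp'
    obtain ⟨A, hAT, hAi, hA⟩ := IH hT' (deletion a F ∪ {B, insert n B}) (by
        rintro X (hX | rfl | rfl)
        · exact hHs X hX
        · exact hBT.trans (subset_insert _ _)
        · exact insert_subset_insert _ hBT) (by
        rintro X (hX | rfl | rfl) Y (hY | rfl | rfl)
        · exact hHW X hX Y hY
        · exact (hB X hX).1
        · exact (hB X hX).2
        · exact (hB Y hY).1.symm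
        · exact WS.refl _
        · exact hBn
        · exact (hB Y hY).2.symm
        · exact hBn.symm
        · exact WS.refl _) (i - 1) (by omega)
    have hnA : n ∉ A := fun h => lt_irrefl _ (hT' n (hAT h))
    have hA' : ∀ x ∈ A, x < n := fun x hx => hT' x (hAT hx)
    have hB' : ∀ x ∈ B, x < n := fun x hx => hT' x (hBT hx)
    have haA : ∀ x ∈ insert n A, a < x := fun x hx => ha' x (insert_subset_insert n hAT hx)
    have haB : ∀ x ∈ insert n B, a < x := fun x hx => ha' x (insert_subset_insert n hBT hx)
    have haAm : a ∉ insert n A := fun h => lt_irrefl _ (haA a h)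
    have cBA : #B = #A + 1 := by omega
    have hAB : Precedes A B :=
      WS.precedes_of_eq hA' hB' (hA (insert n B) (Or.inr (Or.inr rfl))).1.symm (by omega)
    by_contra! hK
    obtain ⟨W₁, hW₁F, hW₁⟩ := hK B (hBT.trans (subset_insert _ _)) hBi
    obtain ⟨X, hXF, hX⟩ := hK (insert a A) (insert_subset_insert _ hAT)
      (by rw [card_insert_of_notMem fun h => haAm (mem_insert_of_mem h)]; omega)
    rcases mem_deletion_or (a := a) hW₁F with ⟨-, h⟩ | ⟨W, hW', rfl⟩
    · exact hW₁ (hB _ h).1 (hB _ h).2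
    have haW : ∀ x ∈ W, a < x := fun x hx => ha' x (hHs W hW' hx)
    rcases mem_deletion_or (a := a) hXF with ⟨haX, hX'⟩ | ⟨X', hX', rfl⟩
    swap
    · refine hX ((ws_insert_insert_iff hX'.1 fun h => haAm (mem_insert_of_mem h)).2
        (hA _ (Or.inl hX')).1) ?_
      rw [insert_comm]
      exact (ws_insert_insert_iff hX'.1 haAm).2 (hA _ (Or.inl hX')).2
    have haX' : ∀ x ∈ X, a < x := fun x hx => ha' x (hHs X hX' hx)
    have hXA := hA X (Or.inl hX')
    have hWA := hA W (Or.inl hW')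
    have hXB := hB X hX'
    have hWB := hB W hW'
    have hle : ∀ x ∈ insert n T, x ≤ n := by
      intro x hx
      rcases mem_insert.1 hx with rfl | hx
      exacts [le_rfl, (hT' x hx).le]
    have haA' : ∀ x ∈ A, a < x := fun x hx => haA x (mem_insert_of_mem hx)
    have haB' : ∀ x ∈ B, a < x := fun x hx => haB x (mem_insert_of_mem hx)
    have key := WS.chain hA' hB' (fun x hx => hle x (hHs X hX' hx))
      (fun x hx => hle x (hHs W hW' hx)) cBA hAB hXA.1 hXA.2 hXB.1 hXB.2 hWA.1 hWA.2 hWB.1 hWB.2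
      (hHW _ hX' _ hW') (by
        by_contra! hc
        refine hX ((ws_insert_min_iff haX' haA' hXA.1).2 hc.1) ?_
        rw [insert_comm]
        refine (ws_insert_min_iff haX' haA hXA.2).2 ?_
        rw [card_insert_of_notMem hnA]
        exact hc.2) (by
        by_contra! hc
        refine hW₁ ((ws_insert_min_iff haB' haW hWB.1.symm).2 hc.1).symm
          ((ws_insert_min_iff haB haW hWB.2.symm).2 ?_).symm
        rw [card_insert_of_notMem hnB]
        exact hc.2)
    exact key.2 ((ws_insert_min_iff haX' haW (hHW _ hX' _ hW')).1 (hW _ hXF _ hW₁F) key.1)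


variable {A B X W : Finset α}
/-- If `#A = #X`, then `A \ X` is a singleton or `X \ A` has two elements. -/
theorem unique_or_exists_ne (h : #A = #X) {p q : α} (hp : p ∈ A ∧ p ∉ X) :
    (∀ x ∈ A, x ∉ X → x = p) ∨ ∃ d ∈ X, d ∉ A ∧ d ≠ q := by
  by_contra! hc
  obtain ⟨⟨x, hx, hx', hxp⟩, hd⟩ := hc
  have h1 : X \ A ⊆ {q} := fun d hd' => by
    rw [mem_sdiff] at hd'
    exact mem_singleton.2 (hd d hd'.1 hd'.2)
  have h2 : {p, x} ⊆ A \ X := by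
    intro d hd'
    rw [mem_insert, mem_singleton] at hd'
    rcases hd' with rfl | rfl
    · exact mem_sdiff.2 hp
    · exact mem_sdiff.2 ⟨hx, hx'⟩
  have h3 := card_le_card h1
  have h4 := card_le_card h2
  rw [card_pair (Ne.symm hxp)] at h4
  rw [card_singleton] at h3
  have := card_sdiff_add_card_inter A X
  have := card_sdiff_add_card_inter X A
  rw [inter_comm] at this
  omega

theorem WS.trans_insert {z : α} (hz : z ∉ A) (XA : WS X A) (XC : WS X (insert z A))
    (WA : WS W A) (WC : WS W (insert z A)) (h1 : #X ≤ #A ∧ ¬ Precedes A X)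
    (h2 : #A + 1 ≤ #W ∧ ¬ Precedes W (insert z A)) : ¬ Precedes W X := by
  have hcC := card_insert_of_notMem hz
  have hC : ∀ x, x ∈ insert z A ↔ x ∈ A ∨ x = z := fun x => by rw [mem_insert, or_comm]
  generalize insert z A = C at *
  obtain ⟨c1, h1⟩ := h1
  obtain ⟨c2, h2⟩ := h2
  obtain ⟨p, q, hpq, h1⟩ := not_precedes_iff.1 h1
  obtain ⟨s, t, hts, h2⟩ := not_precedes_iff.1 h2
  obtain ⟨w, hw⟩ := exists_mem_notMem_of_card_lt (show #X < #W by omega)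
  intro hWX
  have hCX := XC.2.1 (by omega)
  have hWA := WA.1 (by omega)
  rcases c1.lt_or_eq with c1 | c1 <;> rcases c2.lt_or_eq with c2 | c2
  · have hAX := XA.2.1 c1
    have hWC := WC.1 (by omega)
    have := hWA z t s
    have := hWC w t s
    have := hAX t q p
    have := hAX w q p
    have := hWC q t s
    have := hCX t q p
    have := hWX w q
    have := hWX w t
    clear hAX hCX hWA hWC hWX
    grind (splits := 60) (splitImp := true)
  · have hAX := XA.2.1 c1
    have hWC := (WC.2.2 (by omega)).1
    rcases unique_or_exists_ne (q := t) (hcC.trans c2).symm ⟨h2.1, h2.2.1⟩ with hu' | ⟨f, hf⟩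
    · have := hAX t z p
      have := hAX w q p
      have := hWA z t s
      have := hCX t q p
      have := hWX w q
      have := hWX w t
      clear hAX hCX hWA hWC hWX
      grind (splits := 60) (splitImp := true)
    · have := hWC w z s f
      have := hWC q t s f
      have := hWA w t s
      have := hAX w q p
      have := hAX f q p
      have := hWA q f s
      have := hAX t q p
      have := hWA w f s
      have := hCX z q p
      have := hWA q t s
      have := hWX w q
      have := hWX w t
      have := hWX w f
      clear hAX hCX hWA hWC hWX
      grind (splits := 60) (splitImp := true)
  · have hAX := (XA.2.2 c1).2
    have hWC := WC.1 (by omega)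
    rcases unique_or_exists_ne (q := q) c1.symm ⟨h1.1, h1.2.1⟩ with hu | ⟨d, hd⟩
    · have := hWA z t s
      have := hWC q t s
      have := hCX z q p
      have := hWC w t s
      have := hWX w q
      have := hWX w t
      clear hAX hCX hWA hWC hWX
      grind (splits := 60) (splitImp := true)
    · have := hAX t z p d
      have := hAX w z p d
      have := hWC d t s
      have := hCX w q p
      have := hWA q t s
      have := hCX t d p
      have := hWC w t s
      have := hCX t q p
      have := hWC q t s
      have := hCX w d p
      have := hWX w q
      have := hWX w t
      have := hWX w d
      clear hAX hCX hWA hWC hWX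
      grind (splits := 60) (splitImp := true)
  · have hAX := (XA.2.2 c1).2
    have hWC := (WC.2.2 (by omega)).1
    rcases unique_or_exists_ne (q := q) c1.symm ⟨h1.1, h1.2.1⟩ with hu | ⟨d, hd⟩ <;>
      rcases unique_or_exists_ne (q := t) (hcC.trans c2).symm ⟨h2.1, h2.2.1⟩ with hu' | ⟨f, hf⟩
    · have := hCX t q p
      have := hWA z t s
      have := hWX w q
      have := hWX w t
      clear hAX hCX hWA hWC hWX
      grind (splits := 60) (splitImp := true)
    · have := hWC q t s f
      have := hWC w t s f
      have := hWA w f s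
      have := hWA q t s
      have := hCX z q p
      have := hWA w t s
      have := hWA q f s
      have := hWX w t
      have := hWX w q
      have := hWX w f
      clear hAX hCX hWA hWC hWX
      grind (splits := 60) (splitImp := true)
    · have := hAX w q p d
      have := hAX t z p d
      have := hCX t d p
      have := hCX w d p
      have := hWA q t s
      have := hCX w q p
      have := hCX t q p
      have := hWX w t
      have := hWX w d
      have := hWX w q
      clear hAX hCX hWA hWC hWX
      grind (splits := 60) (splitImp := true)
    · have := hWC w z s f
      have := hWC q z s f
      have := hAX t z p d
      have := hAX w z p s
      have := hCX w q p
      have := hCX f q p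
      have := hWA q f s
      have := hWA w f s
      have := hWA w t s
      have := hWA w p s
      have := hCX f s p
      have := hCX w s p
      have := hCX t d p
      have := hCX t q p
      have := hWA d t s
      have := hWA q t s
      have := hWX s d
      have := hWX w q
      have := hWX p t
      have := hWX w d
      have := hWX w f
      have := hWX s t
      have := hWX s q
      have := hWX w t
      clear hAX hCX hWA hWC hWX
      grind (splits := 60) (splitImp := true)
theorem WS.not_precedes_of_precedes_left {X Y Z : Finset α} (hc : #Y = #Z) (hZY : Precedes Z Y)
    (hZX : WS Z X) (hle : #Z ≤ #X) (h : ¬ Precedes Z X) (hne : X ≠ Y) : ¬ Precedes Y X := by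
  by_cases e : Z = Y
  · rwa [← e]
  obtain ⟨p, q, hpq, h⟩ := not_precedes_iff.1 h
  obtain ⟨b, hb⟩ := exists_mem_notMem_of_ne (hc.trans_le hle) hne.symm
  obtain ⟨d, hd⟩ := exists_mem_notMem_of_ne hc.ge e
  intro hYX
  rcases hle.lt_or_eq with hlt | heq
  · have hXZ := hZX.2.1 hlt
    have := hXZ q p b
    have := hXZ q p d
    have := hYX d b
    have := hYX p b
    have := hZY p d
    have := hZY b d
    clear hXZ hYX hZY hZX
    grind (splits := 60) (splitImp := true)
  · obtain ⟨a, ha⟩ := exists_mem_notMem_of_ne (heq.symm.trans hc.symm).le hne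
    obtain ⟨c, hc⟩ := exists_mem_notMem_of_ne hc.le (Ne.symm e)
    have hZX := (hZX.2.2 heq).1
    have := hZX a q p d
    have := hZX c q p b
    have := hZY b q
    have := hYX a q
    have := hZY p q
    have := hYX p c
    have := hZY p d
    have := hYX d q
    have := hYX p b
    have := hYX p q
    have := hZY p a
    have := hZY c q
    clear hYX hZY hZX
    grind (splits := 60) (splitImp := true)

theorem WS.not_precedes_of_precedes_right {X Y Z : Finset α} (hc : #Y = #Z) (hYZ : Precedes Y Z)
    (hXZ : WS X Z) (hle : #X ≤ #Z) (h : ¬ Precedes X Z) (hne : X ≠ Y) : ¬ Precedes X Y := by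
  by_cases e : Y = Z
  · rwa [e]
  obtain ⟨p, q, hpq, h⟩ := not_precedes_iff.1 h
  obtain ⟨a, ha⟩ := exists_mem_notMem_of_ne (hle.trans hc.ge) hne
  obtain ⟨c, hc'⟩ := exists_mem_notMem_of_ne hc.le e
  intro hXY
  rcases hle.lt_or_eq with hlt | heq
  · have hZX := hXZ.2.1 hlt
    have := hZX q p c
    have := hZX q p a
    have := hXY p a
    have := hYZ a c
    have := hYZ p c
    have := hXY c a
    clear hXZ hYZ hXY hZX
    grind (splits := 60) (splitImp := true)
  · obtain ⟨b, hb⟩ := exists_mem_notMem_of_ne (hc.trans heq.symm).le hne.symm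
    obtain ⟨d, hd⟩ := exists_mem_notMem_of_ne hc.ge (Ne.symm e)
    have hXZ := (hXZ.2.2 heq).1
    have := hXZ d q p a
    have := hXZ b q p c
    have := hYZ p q
    have := hXY b q
    have := hXY c q
    have := hXY p a
    have := hYZ p b
    have := hYZ d q
    have := hYZ a q
    have := hYZ p c
    have := hXY p q
    have := hXY p d
    clear hXZ hYZ hXY
    grind (splits := 60) (splitImp := true)

theorem Precedes.of_subset {A B : Finset α} (h : A ⊆ B) : Precedes A B :=
  fun _ _ hp hp' => absurd (h hp) hp'

/-- A member `Y` of a weakly separated collection that surrounds no element of a member of the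
same size can be enlarged by one element compatibly with the collection. -/
theorem exists_ws_insert (T : Finset α) : ∀ H : Set (Finset α), (∀ X ∈ H, X ⊆ T) →
    (∀ X ∈ H, ∀ Y ∈ H, WS X Y) → ∀ Y ∈ H, Y ≠ T → (∀ X ∈ H, #X = #Y → NoAlt3 Y X) →
    ∃ z ∉ Y, z ∈ T ∧ (∀ X ∈ H, WS X (insert z Y)) ∧
      ∀ X ∈ H, #Y < #X → Precedes Y X → Precedes (insert z Y) X := by
  induction T using Finset.induction_on_min with
  | empty =>
    intro H hH _ Y hY hne _
    exact absurd (subset_empty.1 (hH Y hY)) hne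
  | insert a T ha IH =>
    intro H hH hW Y hY hne hA
    have hHs : ∀ X ∈ deletion a H, X ⊆ T := fun X => deletion_subset hH
    have hHW := ws_deletion_min ha hH hW
    have haH : ∀ X ∈ deletion a H, ∀ x ∈ X, a < x := fun X hX x hx => ha x (hHs X hX hx)
    have haT : a ∉ T := fun h => lt_irrefl _ (ha a h)
    rcases mem_deletion_or (a := a) hY with ⟨haY, hY'⟩ | ⟨Y, hY', rfl⟩
    · by_cases hall : ∀ X ∈ H, WS X (insert a Y)
      · refine ⟨a, haY, mem_insert_self a T, hall, fun X hX _ hP p q hp hp' hq hq' => ?_⟩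
        rcases mem_insert.1 hp with rfl | hp
        · refine ha q ((mem_insert.1 (hH X hX hq)).resolve_left ?_)
          rintro rfl
          exact hp' hq
        · exact hP p q hp hp' hq fun h => hq' (mem_insert_of_mem h)
      push Not at hall
      obtain ⟨X₀, hX₀, hX₀Y⟩ := hall
      rcases mem_deletion_or (a := a) hX₀ with ⟨haX₀, hX₀'⟩ | ⟨X', hX', rfl⟩
      swap
      · exact absurd ((ws_insert_insert_iff hX'.1 haY).2 (hHW _ hX' _ hY')) hX₀Y
      have hX₀Y' : #X₀ ≤ #Y ∧ ¬ Precedes Y X₀ := by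
        rw [ws_insert_min_iff (haH _ hX₀') (haH _ hY') (hW _ hX₀ _ hY)] at hX₀Y
        push Not at hX₀Y
        exact hX₀Y
      obtain ⟨z, hzY, hzT, hz, hE⟩ := IH (deletion a H) hHs hHW Y hY' (by
          rintro rfl
          exact hX₀Y (Precedes.of_subset (hH _ hX₀)).ws) (by
          intro X hX hc
          rcases hX.2 with hX' | hX'
          · exact hA X hX' hc
          · exact ((ws_insert_min_iff (haH _ hY') (haH _ hX) (hHW _ hY' _ hX)).1
              (hW _ hY _ hX') hc.ge).noAlt3.2)
      have haz : a < z := ha z hzT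
      have haZ : ∀ x ∈ insert z Y, a < x := by
        intro x hx
        rcases mem_insert.1 hx with rfl | hx
        exacts [haz, haH Y hY' x hx]
      have hcz := card_insert_of_notMem hzY
      have hWS : ∀ X ∈ H, WS X (insert z Y) := by
        intro X hX
        rcases mem_deletion_or (a := a) hX with ⟨-, hX'⟩ | ⟨W, hW', rfl⟩
        · exact hz X hX'
        refine ((ws_insert_min_iff haZ (haH W hW') (hz W hW').symm).2 fun hc => ?_).symm
        by_contra hP
        rw [hcz] at hc
        exact WS.trans_insert hzY (hHW _ hX₀' _ hY') (hz _ hX₀') (hHW _ hW' _ hY') (hz _ hW')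
          hX₀Y' ⟨hc, hP⟩
          ((ws_insert_min_iff (haH _ hX₀') (haH _ hW') (hHW _ hX₀' _ hW')).1
            (hW _ hX₀ _ hX) (by omega))
      refine ⟨z, hzY, mem_insert_of_mem hzT, hWS, fun X hX hc hP => ?_⟩
      rcases mem_deletion_or (a := a) hX with ⟨-, hX'⟩ | ⟨X', hX', rfl⟩
      · exact hE X hX' hc hP
      have hYX' : Y ⊆ X' := by
        intro p hp
        by_contra hp'
        have hpa := haH Y hY' p hp
        exact lt_asymm hpa (hP p a hp (fun h => (mem_insert.1 h).elim hpa.ne' hp')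
          (mem_insert_self a X') haY)
      rw [card_insert_of_notMem hX'.1] at hc
      have hne' : #Y ≠ #X' := fun e => hX₀Y (by
        rw [eq_of_subset_of_card_le hYX' e.ge]
        exact hW _ hX₀ _ hX)
      have hPz := hE X' hX' (by omega) (Precedes.of_subset hYX')
      have hX₀X' := (ws_insert_min_iff (haH _ hX₀') (haH _ hX') (hHW _ hX₀' _ hX')).1
        (hW _ hX₀ _ hX) (by omega)
      have hzX' : z ∈ X' := by
        by_contra hzX'
        obtain ⟨p, q, hpq, hp, hp', hq, hq'⟩ := not_precedes_iff.1 hX₀Y'.2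
        have hXz := (hWS X₀ hX₀).2.1 (by omega)
        have := hXz z q p
        have := hX₀X' p q
        have := hX₀X' p z
        have := hPz z q
        have := hYX' hp
        clear hXz hX₀X' hPz
        grind (splits := 40) (splitImp := true)
      exact Precedes.of_subset
        (insert_subset (mem_insert_of_mem hzX') (hYX'.trans (subset_insert _ _)))
    · have haY := hY'.1
      have hcY := card_insert_of_notMem haY
      have hPeq : ∀ X ∈ deletion a H, X ∈ H → #X ≤ #Y + 1 → Precedes Y X := by
        intro X hX' hX hc
        rcases hc.lt_or_eq with hc | hc
        · exact (ws_insert_min_iff (haH _ hX') (haH _ hY') (hHW _ hX' _ hY')).1 (hW _ hX _ hY)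
            (by omega)
        · intro p q hp hp' hq hq'
          have := hA X hX (by omega) a q p
          have := haH _ hX' q hq
          have := hX'.1
          grind (splits := 40) (splitImp := true)
      obtain ⟨z, hzY, hzT, hz, hE⟩ := IH (deletion a H) hHs hHW Y hY' (by
          rintro rfl
          exact hne rfl) (by
          intro X hX hc
          rcases hX.2 with hX' | hX'
          · exact (hPeq X hX hX' (by omega)).noAlt3.1
          · intro x y z
            have := hA _ hX' (by rw [hcY, card_insert_of_notMem hX.1, hc]) x y z
            have := hX.1
            grind (splits := 40) (splitImp := true))
      have haz : a < z := ha z hzT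
      have haZ : ∀ x ∈ insert z Y, a < x := by
        intro x hx
        rcases mem_insert.1 hx with rfl | hx
        exacts [haz, haH Y hY' x hx]
      have haZ' : a ∉ insert z Y := fun h => lt_irrefl _ (haZ a h)
      have hcz := card_insert_of_notMem hzY
      refine ⟨z, fun h => (mem_insert.1 h).elim haz.ne' hzY, mem_insert_of_mem hzT, ?_, ?_⟩
      · intro X hX
        rw [insert_comm]
        rcases mem_deletion_or (a := a) hX with ⟨-, hX'⟩ | ⟨X', hX', rfl⟩
        · refine (ws_insert_min_iff (haH _ hX') haZ (hz _ hX')).2 fun hc => ?_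
          rw [hcz] at hc
          have hP := hPeq X hX' hX hc
          rcases hc.lt_or_eq with hc | hc
          · have hN := (hz X hX').2.1 (by omega)
            intro p q hp hp' hq hq'
            obtain ⟨y, hy, hyX⟩ := exists_mem_notMem_of_card (show #X ≤ #Y by omega) hq
              fun h => hq' (mem_insert_of_mem h)
            have := hN y q p
            have := hP p q
            have := hP y q
            clear hN hP
            grind (splits := 40) (splitImp := true)
          · exact hE X hX' (by omega) hP
        · exact (ws_insert_insert_iff hX'.1 haZ').2 (hz X' hX')
      · intro X hX hc hP
        rw [insert_comm]
        rw [hcY] at hc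
        rcases mem_deletion_or (a := a) hX with ⟨haX, hX'⟩ | ⟨X', hX', rfl⟩
        · have hE := hE X hX' (by omega) fun p q => by
            have := hP p q
            have := haH _ hX' q
            have := haH _ hY' p
            grind (splits := 40) (splitImp := true)
          intro p q
          have := hE p q
          have := haH _ hX' q
          clear hE hP
          grind (splits := 40) (splitImp := true)
        · have haX := hX'.1
          rw [card_insert_of_notMem haX] at hc
          have hE := hE X' hX' (by omega) fun p q => by
            have := hP p q
            have := haH _ hX' q
            have := haH _ hY' p
            grind (splits := 40) (splitImp := true)
          intro p q
          have := hE p q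
          clear hE hP
          grind (splits := 40) (splitImp := true)



/-- A family of subsets of `T` that is maximal among the pairwise weakly separated ones. -/
structure MaxWS (T : Finset α) (F : Set (Finset α)) : Prop where
  subset : ∀ X ∈ F, X ⊆ T
  ws : ∀ X ∈ F, ∀ Y ∈ F, WS X Y
  mem : ∀ Z ⊆ T, (∀ X ∈ F, WS X Z) → Z ∈ F

theorem Precedes.eq_of_precedes (h : Precedes X Y) (h' : Precedes Y X) (hc : #X = #Y) : X = Y := by
  by_contra hne
  obtain ⟨q, hq, hq'⟩ := exists_mem_notMem_of_ne hc.le hne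
  obtain ⟨p, hp, hp'⟩ := exists_mem_notMem_of_ne hc.ge (Ne.symm hne)
  exact lt_asymm (h p q hp hp' hq hq') (h' q p hq hq' hp hp')

theorem precedes_or_precedes (h : NoAlt3 X Y) (h' : NoAlt3 Y X) : Precedes X Y ∨ Precedes Y X := by
  by_contra! hc
  obtain ⟨⟨p, q, hpq, hp⟩, r, s, hrs, hr⟩ := hc.imp not_precedes_iff.1 not_precedes_iff.1
  have := h s r p
  have := h s q p
  have := h' q p r
  have := h' q s r
  have := h p r s
  have := h' r p q
  have := h' r s q
  have := h p q s
  clear h h' hc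
  grind (splits := 40) (splitImp := true)

theorem ws_deletion_max {T : Finset α} (hn : ∀ x ∈ T, x < n) {F : Set (Finset α)}
    (hF : ∀ X ∈ F, X ⊆ insert n T) (hW : ∀ X ∈ F, ∀ Y ∈ F, WS X Y) :
    ∀ X ∈ deletion n F, ∀ Y ∈ deletion n F, WS X Y := by
  intro X hX Y hY
  have hX' : ∀ x ∈ X, x < n := fun x hx => hn x (deletion_subset hF hX hx)
  have hY' : ∀ x ∈ Y, x < n := fun x hx => hn x (deletion_subset hF hY hx)
  obtain ⟨hnX, hX | hX⟩ := hX <;> obtain ⟨hnY, hY | hY⟩ := hY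
  · exact hW _ hX _ hY
  · exact (hW _ hX _ hY).of_insert_max hX' hY'
  · exact ((hW _ hX _ hY).symm.of_insert_max hY' hX').symm
  · exact (ws_insert_insert_iff hnX hnY).1 (hW _ hX _ hY)

namespace MaxWS

variable {T : Finset α} {F : Set (Finset α)} {Z : Finset α}

theorem compl (h : MaxWS T F) : MaxWS T ((T \ ·) '' F) where
  subset := by
    rintro _ ⟨X, -, rfl⟩
    exact sdiff_subset
  ws := by
    rintro _ ⟨X, hX, rfl⟩ _ ⟨Y, hY, rfl⟩
    exact (h.ws X hX Y hY).compl (h.subset X hX) (h.subset Y hY)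
  mem Z hZ hW := by
    refine ⟨T \ Z, h.mem _ sdiff_subset fun X hX => ?_, Finset.sdiff_sdiff_eq_self hZ⟩
    have := (hW _ ⟨X, hX, rfl⟩).compl sdiff_subset hZ
    simpa only [Finset.sdiff_sdiff_eq_self (h.subset X hX)] using this

theorem mem_compl_iff (h : MaxWS T F) (hZ : Z ⊆ T) : Z ∈ (T \ ·) '' F ↔ T \ Z ∈ F := by
  constructor
  · rintro ⟨X, hX, rfl⟩
    simpa only [Finset.sdiff_sdiff_eq_self (h.subset X hX)] using hX
  · exact fun hm => ⟨_, hm, Finset.sdiff_sdiff_eq_self hZ⟩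

theorem precedes_of_mem (hn : ∀ x ∈ T, x < n) (h : MaxWS (insert n T) F) (hX : X ∈ F)
    (hnX : n ∉ X) (hY : insert n Y ∈ F) (hnY : n ∉ Y) (hc : #X ≤ #Y) : Precedes X Y := by
  have hX' : ∀ x ∈ X, x < n := fun x hx =>
    hn x (deletion_subset h.subset (a := n) ⟨hnX, Or.inl hX⟩ hx)
  have hY' : ∀ x ∈ Y, x < n := fun x hx =>
    hn x (deletion_subset h.subset (a := n) ⟨hnY, Or.inr hY⟩ hx)
  have hw := h.ws X hX _ hY
  exact (ws_insert_max_iff hX' hY' (hw.of_insert_max hX' hY')).1 hw hc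

theorem mem_of_precedes (hn : ∀ x ∈ T, x < n) (h : MaxWS (insert n T) F) (hZ : Z ⊆ T)
    (hW : ∀ X ∈ deletion n F, WS X Z) (hnY : n ∉ Y) (hY : Y ∈ F)
    (hc : #Y = #Z) (hP : Precedes Z Y) : Z ∈ F := by
  refine h.mem Z (hZ.trans (subset_insert _ _)) fun X hX => ?_
  obtain ⟨-, hX⟩ | ⟨X, hXd, rfl⟩ := mem_deletion_or (a := n) hX
  · exact hW X hX
  · have hs := deletion_subset h.subset hXd
    refine ((ws_insert_max_iff (fun x hx => hn x (hZ hx)) (fun x hx => hn x (hs hx))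
      (hW X hXd).symm).2 fun hle => ?_).symm
    by_contra hnP
    refine WS.not_precedes_of_precedes_left hc hP (hW X hXd).symm hle hnP ?_
      (h.precedes_of_mem hn hY hnY hX hXd.1 (hc.trans_le hle))
    rintro rfl
    exact hnP hP

theorem insert_mem_of_precedes (hn : ∀ x ∈ T, x < n) (h : MaxWS (insert n T) F) (hZ : Z ⊆ T)
    (hW : ∀ X ∈ deletion n F, WS X Z) (hnY : n ∉ Y) (hY' : insert n Y ∈ F)
    (hc : #Y = #Z) (hP : Precedes Y Z) : insert n Z ∈ F := by
  have hnZ : n ∉ Z := fun hm => lt_irrefl _ (hn n (hZ hm))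
  refine h.mem _ (insert_subset_insert _ hZ) fun X hX => ?_
  obtain ⟨-, hX'⟩ | ⟨X, hXd, rfl⟩ := mem_deletion_or (a := n) hX
  · have hs := deletion_subset h.subset hX'
    refine (ws_insert_max_iff (fun x hx => hn x (hs hx)) (fun x hx => hn x (hZ hx))
      (hW X hX')).2 fun hle => ?_
    by_contra hnP
    refine WS.not_precedes_of_precedes_right hc hP (hW X hX') hle hnP ?_
      (h.precedes_of_mem hn hX hX'.1 hY' hnY (hle.trans_eq hc.symm))
    rintro rfl
    exact hnP hP
  · exact (ws_insert_insert_iff hXd.1 hnZ).2 (hW X hXd)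

theorem exists_mem_card (hn : ∀ x ∈ T, x < n) (h : MaxWS (insert n T) F) {i : ℕ} (hi : i ≤ #T) :
    ∃ K ⊆ T, #K = i ∧ K ∈ F ∧ insert n K ∈ F := by
  obtain ⟨K, hK, hc, hW⟩ := exists_ws_and_ws_insert T hn F h.subset h.ws i hi
  exact ⟨K, hK, hc, h.mem K (hK.trans (subset_insert _ _)) fun X hX => (hW X hX).1,
    h.mem _ (insert_subset_insert _ hK) fun X hX => (hW X hX).2⟩

theorem noAlt3 (hn : ∀ x ∈ T, x < n) (h : MaxWS (insert n T) F) (hZ : Z ⊆ T)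
    (hW : ∀ X ∈ deletion n F, WS X Z) (hnY : n ∉ Y) (hY : Y ∈ F) (hY' : insert n Y ∈ F)
    (hc : #Y = #Z) : NoAlt3 Y Z := by
  have hYd : Y ∈ deletion n F := ⟨hnY, Or.inl hY⟩
  have hYT := deletion_subset h.subset hYd
  have hsub : ∀ X ∈ deletion n F, X ⊆ T := fun X => deletion_subset h.subset
  have hws := ws_deletion_max hn h.subset h.ws
  by_cases hYe : Y = T
  · have : Z = T := eq_of_subset_of_card_le hZ (by rw [← hc, hYe])
    rw [this, hYe]
    exact (Precedes.of_subset Subset.rfl).noAlt3.1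
  obtain ⟨z, hzY, hzT, hz, hzP⟩ := exists_ws_insert T (deletion n F) hsub hws Y hYd hYe (by
    intro X hX hXc
    rcases hX with ⟨hnX, hX | hX⟩
    · exact (h.precedes_of_mem hn hX hnX hY' hnY hXc.le).noAlt3.2
    · exact (h.precedes_of_mem hn hY hnY hX hnX hXc.ge).noAlt3.1)
  have hcz := card_insert_of_notMem hzY
  have hzs : insert z Y ⊆ T := insert_subset hzT hYT
  obtain ⟨Y₂, hY₂T, hY₂c, hY₂, hY₂'⟩ := h.exists_mem_card hn (hcz ▸ card_le_card hzs)
  have hnY₂ : n ∉ Y₂ := fun hm => lt_irrefl _ (hn n (hY₂T hm))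
  have hYz : insert z Y ∈ F := h.mem_of_precedes hn hzs hz hnY₂ hY₂ (by omega)
    (hzP Y₂ ⟨hnY₂, Or.inl hY₂⟩ (by omega) (h.precedes_of_mem hn hY hnY hY₂' hnY₂ (by omega)))
  have h3 := (hW _ ⟨fun hm => lt_irrefl _ (hn n (hzs hm)), Or.inl hYz⟩).1 (by omega)
  have h4 := (hW Y hYd).2.2 hc
  intro x y w hx hx' hy hy' hw hw' hxy hyw
  obtain ⟨v, hv, hvY, hvy⟩ : ∃ v ∈ Z, v ∉ Y ∧ v ≠ y := by
    have h2 : 1 < #(Z \ Y) := by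
      rw [card_sdiff_comm hc.symm, one_lt_card]
      exact ⟨x, mem_sdiff.2 ⟨hx, hx'⟩, w, mem_sdiff.2 ⟨hw, hw'⟩, (hxy.trans hyw).ne⟩
    obtain ⟨v, hv, hne⟩ := exists_mem_ne h2 y
    exact ⟨v, (mem_sdiff.1 hv).1, (mem_sdiff.1 hv).2, hne⟩
  have := h3 x y w
  have := h3 x v w
  have := h4.1 x y w v
  have := h4.2 v x y w
  clear h3 h4 hW hzP hz hn hsub hws h
  grind (splits := 40) (splitImp := true)

theorem noAlt3_symm (hn : ∀ x ∈ T, x < n) (h : MaxWS (insert n T) F) (hZ : Z ⊆ T)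
    (hW : ∀ X ∈ deletion n F, WS X Z) (hnY : n ∉ Y) (hY : Y ∈ F) (hY' : insert n Y ∈ F)
    (hc : #Y = #Z) : NoAlt3 Z Y := by
  have hnT : n ∉ T := fun hm => lt_irrefl _ (hn n hm)
  have hYT := deletion_subset h.subset (a := n) ⟨hnY, Or.inl hY⟩
  have e1 : ∀ X ⊆ T, insert n T \ X = insert n (T \ X) := fun X hX =>
    insert_sdiff_of_notMem _ fun hm => hnT (hX hm)
  have e2 : ∀ X, insert n T \ insert n X = T \ X := fun X => by
    rw [insert_sdiff_insert, sdiff_insert_of_notMem hnT]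
  have i1 : ∀ X ⊆ T, X ∈ (insert n T \ ·) '' F ↔ insert n (T \ X) ∈ F := fun X hX => by
    rw [h.mem_compl_iff (hX.trans (subset_insert _ _)), e1 X hX]
  have i2 : ∀ X ⊆ T, insert n X ∈ (insert n T \ ·) '' F ↔ T \ X ∈ F := fun X hX => by
    rw [h.mem_compl_iff (insert_subset_insert _ hX), e2]
  have hn' : ∀ X, n ∉ T \ X := fun X hm => hnT (mem_sdiff.1 hm).1
  have := h.compl.noAlt3 (Z := T \ Z) (Y := T \ Y) hn sdiff_subset (fun X hX => ?_) (hn' Y)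
    ((i1 _ sdiff_subset).2 (by rwa [Finset.sdiff_sdiff_eq_self hYT]))
    ((i2 _ sdiff_subset).2 (by rwa [Finset.sdiff_sdiff_eq_self hYT]))
    (by rw [card_sdiff_of_subset hYT, card_sdiff_of_subset hZ, hc])
  · intro x y z hx hx' hy hy' hz hz'
    exact this x y z (mem_sdiff.2 ⟨hZ hx, hx'⟩) (by simp [hx]) (mem_sdiff.2 ⟨hYT hy, hy'⟩)
      (by simp [hy]) (mem_sdiff.2 ⟨hZ hz, hz'⟩) (by simp [hz])
  · have hXT := deletion_subset h.compl.subset hX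
    have := hW (T \ X) ⟨hn' X, hX.2.symm.imp (i2 X hXT).1 (i1 X hXT).1⟩
    simpa only [Finset.sdiff_sdiff_eq_self hXT] using this.compl sdiff_subset hZ

theorem deletion (hn : ∀ x ∈ T, x < n) (h : MaxWS (insert n T) F) : MaxWS T (deletion n F) where
  subset _ := deletion_subset h.subset
  ws := ws_deletion_max hn h.subset h.ws
  mem Z hZ hW := by
    have hnT : n ∉ T := fun hm => lt_irrefl _ (hn n hm)
    obtain ⟨Y, hYT, hc, hY, hY'⟩ := h.exists_mem_card hn (card_le_card hZ)
    have hnY : n ∉ Y := fun hm => hnT (hYT hm)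
    refine ⟨fun hm => hnT (hZ hm), ?_⟩
    obtain hP | hP := precedes_or_precedes (h.noAlt3 hn hZ hW hnY hY hY' hc)
      (h.noAlt3_symm hn hZ hW hnY hY hY' hc)
    · exact Or.inr (h.insert_mem_of_precedes hn hZ hW hnY hY' hc hP)
    · exact Or.inl (h.mem_of_precedes hn hZ hW hnY hY hc hP)

theorem existsUnique_card (hn : ∀ x ∈ T, x < n) (h : MaxWS (insert n T) F) {i : ℕ}
    (hi : i ≤ #T) : ∃! K, (n ∉ K ∧ K ∈ F ∧ insert n K ∈ F) ∧ #K = i := by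
  obtain ⟨K, hKT, hc, hK⟩ := h.exists_mem_card hn hi
  have hnK : n ∉ K := fun hm => lt_irrefl _ (hn n (hKT hm))
  refine ⟨K, ⟨⟨hnK, hK⟩, hc⟩, fun L ⟨⟨hnL, hL⟩, hLc⟩ => ?_⟩
  exact (h.precedes_of_mem hn hL.1 hnL hK.2 hnK (by omega)).eq_of_precedes
    (h.precedes_of_mem hn hK.1 hnK hL.2 hnL (by omega)) (by omega)

theorem card_eq (T : Finset α) : ∀ F : Finset (Finset α), MaxWS T (F : Set (Finset α)) →
    #F = (#T + 1).choose 2 + 1 := by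
  induction T using Finset.induction_on_max with
  | empty =>
    intro F hF
    have : F = {∅} := by
      refine eq_singleton_iff_unique_mem.2 ⟨hF.mem ∅ Subset.rfl fun X hX => ?_, fun X hX =>
        subset_empty.1 (hF.subset X hX)⟩
      rw [subset_empty.1 (hF.subset X hX)]
      exact WS.refl _
    simp [this]
  | insert n T hn ih =>
    intro F hF
    have hnT : n ∉ T := fun hm => lt_irrefl _ (hn n hm)
    let V := F.filter (n ∉ ·)
    let U := (F.filter (n ∈ ·)).image (erase · n)
    have hU : ∀ X, X ∈ U ↔ n ∉ X ∧ insert n X ∈ F := by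
      intro X
      simp only [U, mem_image, mem_filter]
      constructor
      · rintro ⟨X, ⟨hX, hnX⟩, rfl⟩
        exact ⟨notMem_erase n X, by rwa [insert_erase hnX]⟩
      · rintro ⟨hnX, hX⟩
        exact ⟨_, ⟨hX, mem_insert_self n X⟩, erase_insert hnX⟩
    have hUc : #U = #(F.filter (n ∈ ·)) := card_image_of_injOn fun X hX Y hY hXY => by
      rw [← insert_erase (mem_filter.1 hX).2, ← insert_erase (mem_filter.1 hY).2]
      exact congrArg _ hXY
    have hD : ((V ∪ U : Finset (Finset α)) : Set (Finset α)) = _root_.deletion n F := by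
      ext X
      simp only [mem_coe, mem_union, hU, V, mem_filter, _root_.deletion, Set.mem_ofPred_eq]
      tauto
    have hM : ∀ X, X ∈ V ∩ U ↔ n ∉ X ∧ X ∈ F ∧ insert n X ∈ F := by
      intro X
      rw [mem_inter, hU, mem_filter]
      tauto
    have hMc : #(V ∩ U) = #T + 1 := by
      rw [← card_range (#T + 1)]
      refine card_nbij card (fun X hX => ?_) (fun X hX Y hY hXY => ?_) fun i hi => ?_
      · have hX := (hM X).1 hX
        have := card_le_card (deletion_subset hF.subset (a := n) ⟨hX.1, Or.inl hX.2.1⟩)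
        simpa [Nat.lt_succ_iff] using this
      · have hX := (hM X).1 hX
        have := card_le_card (deletion_subset hF.subset (a := n) ⟨hX.1, Or.inl hX.2.1⟩)
        exact (hF.existsUnique_card hn this).unique ⟨hX, rfl⟩ ⟨(hM Y).1 hY, hXY.symm⟩
      · obtain ⟨K, hK, -⟩ := hF.existsUnique_card hn (Nat.lt_succ_iff.1 (mem_range.1 hi))
        exact ⟨K, (hM K).2 hK.1, hK.2⟩
    have h1 := ih _ (hD ▸ hF.deletion hn)
    have h2 := card_union_add_card_inter V U
    have h3 : #V + #U = #F := by
      rw [hUc, add_comm]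
      exact card_filter_add_card_filter_not _
    rw [card_insert_of_notMem hnT, Nat.choose_succ_succ' (#T + 1) 1, Nat.choose_one_right,
      one_add_one_eq_two]
    omega

end MaxWS

theorem WS.noAlt3_or_noAlt3 (h : WS X Y) (hc : #X = #Y) : NoAlt3 X Y ∨ NoAlt3 Y X := by
  have h4 := h.2.2 hc
  clear h
  unfold NoAlt3
  by_contra! hn
  obtain ⟨⟨x, y, z, hx, hx', hy, hy', hz, hz', hxy, hyz⟩,
    u, v, w, hu, hu', hv, hv', hw, hw', huv, hvw⟩ := hn
  have := h4.1 x y z w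
  have := h4.1 x y v w
  have := h4.2 u x y z
  have := h4.2 u v y z
  have := h4.2 u v w z
  have := h4.1 x u v w
  clear h4
  grind (splits := 40) (splitImp := true)

end Separation

section Bridge

variable {A B P Q : Finset ℕ}

theorem setLT_iff (hQ : 0 ∉ Q) : SetLT P Q ↔ Q.Nonempty ∧ ∀ p ∈ P, ∀ q ∈ Q, p < q := by
  unfold SetLT max0 min0
  by_cases hQn : Q.Nonempty
  · have h0 := ne_of_mem_of_not_mem (Q.min'_mem hQn) hQ
    rw [dif_pos hQn, and_iff_right hQn]
    by_cases hP : P.Nonempty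
    · simp only [dif_pos hP, max'_lt_iff, lt_min'_iff]
      exact ⟨fun h p hp q hq => h q hq p hp, fun h q hq p hp => h p hp q hq⟩
    · rw [dif_neg hP, not_nonempty_iff_eq_empty.1 hP]
      simpa using Nat.pos_of_ne_zero h0
  · simp [hQn]

theorem lessDot_iff (hB : 0 ∉ B) : LessDot A B ↔ (B \ A).Nonempty ∧ Precedes A B := by
  rw [LessDot, setLT_iff fun h => hB (mem_sdiff.1 h).1]
  simp only [Precedes, mem_sdiff]
  grind

theorem stronglySep_iff (hA : 0 ∉ A) (hB : 0 ∉ B) :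
    StronglySep A B ↔ Precedes A B ∨ Precedes B A := by
  rw [StronglySep, lessDot_iff hA, lessDot_iff hB]
  constructor
  · rintro (h | h | rfl)
    · exact Or.inl h.2
    · exact Or.inr h.2
    · exact Or.inl (Precedes.of_subset Subset.rfl)
  · intro h
    by_cases h1 : A ⊆ B
    · by_cases h2 : B ⊆ A
      · exact Or.inr (Or.inr (h1.antisymm h2))
      · exact Or.inl ⟨sdiff_nonempty.2 h2, Precedes.of_subset h1⟩
    · by_cases h2 : B ⊆ A
      · exact Or.inr (Or.inl ⟨sdiff_nonempty.2 h1, Precedes.of_subset h2⟩)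
      · exact h.imp (fun h => ⟨sdiff_nonempty.2 h2, h⟩) fun h => Or.inl ⟨sdiff_nonempty.2 h1, h⟩

theorem Splits.noAlt3 (hA : 0 ∉ A) (hB : 0 ∉ B) (h : Splits A B) : NoAlt3 A B := by
  obtain ⟨-, B', B'', -, -, hU, h1, h2⟩ := h
  have hB'' : 0 ∉ B'' := fun hm => hB (mem_sdiff.1 (hU ▸ mem_union_right _ hm)).1
  have h1 := ((setLT_iff fun h => hA (mem_sdiff.1 h).1).1 h1).2
  have h2 := ((setLT_iff hB'').1 h2).2
  intro x y z hx hx' hy hy' hz hz' hxy hyz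
  rcases mem_union.1 (hU ▸ mem_sdiff.2 ⟨hy, hy'⟩) with h | h
  · exact lt_asymm hxy (h1 y h x (mem_sdiff.2 ⟨hx, hx'⟩))
  · exact lt_asymm hyz (h2 z (mem_sdiff.2 ⟨hz, hz'⟩) y h)

theorem NoAlt3.stronglySep_or_splits (hA : 0 ∉ A) (hB : 0 ∉ B) (h : NoAlt3 A B) :
    StronglySep A B ∨ Splits A B := by
  rw [stronglySep_iff hA hB, or_iff_not_imp_left, not_or, not_precedes_iff, not_precedes_iff]
  rintro ⟨⟨p, q, hqp, hp, hp', hq, hq'⟩, r, s, hsr, hr, hr', hs, hs'⟩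
  refine ⟨⟨p, mem_sdiff.2 ⟨hp, hp'⟩⟩, (B \ A).filter fun b => ∃ a ∈ A \ B, b < a,
    (B \ A).filter fun b => ∃ a ∈ A \ B, a < b,
    ⟨q, mem_filter.2 ⟨mem_sdiff.2 ⟨hq, hq'⟩, p, mem_sdiff.2 ⟨hp, hp'⟩, hqp⟩⟩,
    ⟨r, mem_filter.2 ⟨mem_sdiff.2 ⟨hr, hr'⟩, s, mem_sdiff.2 ⟨hs, hs'⟩, hsr⟩⟩, ?_, ?_, ?_⟩
  · rw [← filter_or, filter_eq_self]
    intro b hb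
    have hpb : p ≠ b := fun e => hp' (e ▸ (mem_sdiff.1 hb).1)
    exact hpb.lt_or_gt.symm.imp (fun h => ⟨p, mem_sdiff.2 ⟨hp, hp'⟩, h⟩)
      fun h => ⟨p, mem_sdiff.2 ⟨hp, hp'⟩, h⟩
  · rw [setLT_iff fun h => hA (mem_sdiff.1 h).1]
    refine ⟨⟨p, mem_sdiff.2 ⟨hp, hp'⟩⟩, fun b hb a ha => ?_⟩
    simp only [mem_filter, mem_sdiff] at hb ha
    obtain ⟨hb, c, hc, hbc⟩ := hb
    have hab : a ≠ b := fun e => ha.2 (e ▸ hb.1)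
    exact hab.lt_or_gt.resolve_left fun hlt => h a b c ha.1 ha.2 hb.1 hb.2 hc.1 hc.2 hlt hbc
  · rw [setLT_iff fun h => hB (mem_sdiff.1 (mem_filter.1 h).1).1]
    refine ⟨⟨r, mem_filter.2 ⟨mem_sdiff.2 ⟨hr, hr'⟩, s, mem_sdiff.2 ⟨hs, hs'⟩, hsr⟩⟩,
      fun a ha b hb => ?_⟩
    simp only [mem_filter, mem_sdiff] at hb ha
    obtain ⟨hb, c, hc, hcb⟩ := hb
    have hab : a ≠ b := fun e => ha.2 (e ▸ hb.1)
    exact hab.lt_or_gt.resolve_right fun hlt => h c b a hc.1 hc.2 hb.1 hb.2 ha.1 ha.2 hcb hlt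

theorem NoAlt3.ws (h : NoAlt3 A B) (hc : #B ≤ #A) : WS A B :=
  ⟨fun _ => h, fun hlt => absurd hc hlt.not_ge, fun _ => h.noAlt4⟩

theorem weaklySep_iff (hA : 0 ∉ A) (hB : 0 ∉ B) : WeaklySep A B ↔ WS A B := by
  constructor
  · rintro (h | ⟨h, hc⟩ | ⟨h, hc⟩)
    · exact ((stronglySep_iff hA hB).1 h).elim Precedes.ws fun h => h.ws.symm
    · exact (h.noAlt3 hA hB).ws hc
    · exact ((h.noAlt3 hB hA).ws hc).symm
  · intro h
    have hs : StronglySep B A → StronglySep A B := fun h =>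
      (stronglySep_iff hA hB).2 ((stronglySep_iff hB hA).1 h).symm
    have hl : NoAlt3 A B → #B ≤ #A → WeaklySep A B := fun h hc =>
      (h.stronglySep_or_splits hA hB).imp_right fun h => Or.inl ⟨h, hc⟩
    have hr : NoAlt3 B A → #A ≤ #B → WeaklySep A B := fun h hc =>
      (h.stronglySep_or_splits hB hA).imp hs fun h => Or.inr ⟨h, hc⟩
    rcases lt_trichotomy #A #B with hc | hc | hc
    · exact hr (h.2.1 hc) hc.le
    · exact (h.noAlt3_or_noAlt3 hc).elim (hl · hc.ge) (hr · hc.le)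
    · exact hl (h.1 hc) hc.le

end Bridge

section Intervals

theorem ws_Ico {X : Finset ℕ} {a b : ℕ} (h : #X ≤ b - a) : WS (Ico a b) X := by
  refine NoAlt3.ws ?_ (by rwa [Nat.card_Ico])
  intro x y z hx _ _ hy' hz _ hxy hyz
  rw [mem_Ico] at hx hz
  exact hy' (mem_Ico.2 ⟨hx.1.trans hxy.le, hyz.trans hz.2⟩)

theorem ws_sdiff_Ico {X T : Finset ℕ} {a b : ℕ} (hX : X ⊆ T) (hI : Ico a b ⊆ T)
    (h : #T ≤ #X + (b - a)) : WS (T \ Ico a b) X := by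
  have := (ws_Ico (X := T \ X) (a := a) (b := b)
    (by have := card_sdiff_add_card_eq_card hX; omega)).compl hI sdiff_subset
  rwa [Finset.sdiff_sdiff_eq_self hX] at this

/-- A set that is weakly separated from all intervals with one element less is an interval. -/
theorem eq_Ico_of_ws {Z : Finset ℕ} {n : ℕ} (hZ : Z ⊆ Icc 1 n) (hne : Z.Nonempty)
    (h : ∀ a, 1 ≤ a → a + (#Z - 1) ≤ n + 1 → WS (Ico a (a + (#Z - 1))) Z) :
    ∃ a, 1 ≤ a ∧ a + #Z ≤ n + 1 ∧ Z = Ico a (a + #Z) := by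
  have hlo := Z.min'_mem hne
  have hhi := Z.max'_mem hne
  set lo := Z.min' hne
  set hi := Z.max' hne
  have hsub : Z ⊆ Icc lo hi := fun x hx => mem_Icc.2 ⟨Z.min'_le x hx, Z.le_max' x hx⟩
  have h1 := mem_Icc.1 (hZ hlo)
  have h2 := mem_Icc.1 (hZ hhi)
  have hle := (mem_Icc.1 (hsub hlo)).2
  by_cases hg : Icc lo hi ⊆ Z
  · have e : Z = Icc lo hi := hsub.antisymm hg
    have hc : #Z = hi + 1 - lo := by rw [← Nat.card_Icc, ← e]
    refine ⟨lo, h1.1, by omega, e.trans ?_⟩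
    ext x
    rw [mem_Icc, mem_Ico]
    omega
  · obtain ⟨g, hg, hgZ⟩ := not_subset.1 hg
    have hc := card_lt_card (ssubset_of_subset_of_ne hsub fun e => hgZ (e ▸ hg))
    rw [Nat.card_Icc] at hc
    rw [mem_Icc] at hg
    have hglo : g ≠ lo := fun e => hgZ (e ▸ hlo)
    have hghi : g ≠ hi := fun e => hgZ (e ▸ hhi)
    have hcl : 1 < #Z := one_lt_card.2 ⟨lo, hlo, hi, hhi, by omega⟩
    obtain ⟨a, ha1, ha2, ha3, ha4⟩ :
        ∃ a, lo < a ∧ a ≤ g ∧ g < a + (#Z - 1) ∧ a + (#Z - 1) ≤ hi := by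
      by_cases hlt : g < lo + 1 + (#Z - 1)
      · exact ⟨lo + 1, by omega⟩
      · exact ⟨g + 1 - (#Z - 1), by omega⟩
    have hw := (h a (by omega) (by omega)).2.1 (by rw [Nat.card_Ico]; omega)
    exact absurd (show g < hi by omega) (hw lo g hi hlo (by rw [mem_Ico]; omega)
      (by rw [mem_Ico]; omega) hgZ hhi (by rw [mem_Ico]; omega) (by omega))

/-- The intervals in `[1, n]` with more than `t` elements. -/
def intervals (n t : ℕ) : Finset (Finset ℕ) :=
  ((range (n - t)).sigma fun j => range (n - t - j)).image
    fun p => Ico (p.2 + 1) (p.2 + 1 + (t + 1 + p.1))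

theorem mem_intervals {n t : ℕ} {X : Finset ℕ} :
    X ∈ intervals n t ↔ ∃ a k, 1 ≤ a ∧ t < k ∧ a + k ≤ n + 1 ∧ X = Ico a (a + k) := by
  simp only [intervals, mem_image, mem_sigma, mem_range, Sigma.exists]
  constructor
  · rintro ⟨j, i, h, rfl⟩
    exact ⟨i + 1, t + 1 + j, by omega, by omega, by omega, rfl⟩
  · rintro ⟨a, k, ha, hk, hak, rfl⟩
    refine ⟨k - t - 1, a - 1, by omega, ?_⟩
    congr 1 <;> omega

theorem card_intervals (n t : ℕ) : #(intervals n t) = (n - t + 1).choose 2 := by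
  rw [intervals, card_image_of_injOn, card_sigma]
  · simp only [card_range]
    generalize n - t = d
    induction d with
    | zero => simp
    | succ d ih =>
      rw [sum_range_succ', Nat.choose_succ_succ' (d + 1) 1, Nat.choose_one_right,
        one_add_one_eq_two, ← ih]
      simp only [Nat.add_sub_add_right, Nat.sub_zero]
      omega
  · rintro ⟨j, i⟩ - ⟨j', i'⟩ - h
    replace h : Ico (i + 1) (i + 1 + (t + 1 + j)) = Ico (i' + 1) (i' + 1 + (t + 1 + j')) := h
    have h1 := congrArg card h
    have h2 : i + 1 ∈ Ico (i' + 1) (i' + 1 + (t + 1 + j')) := h ▸ mem_Ico.2 (by omega)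
    have h3 : i' + 1 ∈ Ico (i + 1) (i + 1 + (t + 1 + j)) := h ▸ mem_Ico.2 (by omega)
    rw [Nat.card_Ico, Nat.card_Ico] at h1
    rw [mem_Ico] at h2 h3
    obtain rfl : j = j' := by omega
    obtain rfl : i = i' := by omega
    rfl

theorem choose_two_add (p q : ℕ) :
    (p + q + 1).choose 2 = (p + 1).choose 2 + (q + 1).choose 2 + p * q := by
  induction q with
  | zero => simp
  | succ q ih =>
    rw [← add_assoc, Nat.choose_succ_succ' (p + q + 1) 1, Nat.choose_succ_succ' (q + 1) 1,
      one_add_one_eq_two, ih, Nat.choose_one_right, Nat.choose_one_right]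
    ring

/-- The complements in `[1, n]` of the intervals with more than `t` elements. -/
def coIntervals (n t : ℕ) : Finset (Finset ℕ) :=
  (intervals n t).image (Icc 1 n \ ·)

theorem Ico_subset_Icc_one {n a k : ℕ} (ha : 1 ≤ a) (hak : a + k ≤ n + 1) :
    Ico a (a + k) ⊆ Icc 1 n := fun x hx => by
  rw [mem_Ico] at hx
  rw [mem_Icc]
  omega

theorem subset_of_mem_intervals {n t : ℕ} {X : Finset ℕ} (hX : X ∈ intervals n t) :
    X ⊆ Icc 1 n := by
  obtain ⟨a, k, ha, -, hak, rfl⟩ := mem_intervals.1 hX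
  exact Ico_subset_Icc_one ha hak

theorem lt_card_of_mem_intervals {n t : ℕ} {X : Finset ℕ} (hX : X ∈ intervals n t) : t < #X := by
  obtain ⟨a, k, -, hk, -, rfl⟩ := mem_intervals.1 hX
  rw [Nat.card_Ico]
  omega

theorem ws_of_mem_intervals {n t : ℕ} {X Y : Finset ℕ} (hX : X ∈ intervals n t)
    (h : #Y ≤ #X) : WS X Y := by
  obtain ⟨a, k, -, -, -, rfl⟩ := mem_intervals.1 hX
  exact ws_Ico (by rwa [Nat.card_Ico] at h)

theorem subset_of_mem_coIntervals {n t : ℕ} {X : Finset ℕ} (hX : X ∈ coIntervals n t) :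
    X ⊆ Icc 1 n := by
  obtain ⟨_, -, rfl⟩ := mem_image.1 hX
  exact sdiff_subset

theorem card_add_lt_of_mem_coIntervals {n t : ℕ} {X : Finset ℕ} (hX : X ∈ coIntervals n t) :
    #X + t < n := by
  obtain ⟨Y, hY, rfl⟩ := mem_image.1 hX
  have := lt_card_of_mem_intervals hY
  have := card_sdiff_add_card_eq_card (subset_of_mem_intervals hY)
  rw [Nat.card_Icc] at this
  omega

theorem ws_of_mem_coIntervals {n t : ℕ} {X Y : Finset ℕ} (hX : X ∈ coIntervals n t)
    (hY : Y ⊆ Icc 1 n) (h : #X ≤ #Y) : WS X Y := by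
  obtain ⟨_, hI, rfl⟩ := mem_image.1 hX
  have hs := subset_of_mem_intervals hI
  obtain ⟨a, k, -, -, -, rfl⟩ := mem_intervals.1 hI
  have := card_sdiff_add_card_eq_card hs
  rw [Nat.card_Ico] at this
  exact ws_sdiff_Ico hY hs (by omega)

theorem card_coIntervals (n t : ℕ) : #(coIntervals n t) = (n - t + 1).choose 2 := by
  rw [coIntervals, card_image_of_injOn, card_intervals]
  intro X hX Y hY hXY
  rw [← Finset.sdiff_sdiff_eq_self (subset_of_mem_intervals hX),
    ← Finset.sdiff_sdiff_eq_self (subset_of_mem_intervals hY)]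
  exact congrArg _ hXY

end Intervals

namespace IsMaxWColl

variable {n m : ℕ} {F : Finset (Finset ℕ)} {X Y Z : Finset ℕ}

theorem ws (hF : IsMaxWColl {X : Finset ℕ | X ⊆ Icc 1 n ∧ #X = m} F) (hX : X ∈ F) (hY : Y ∈ F) :
    WS X Y := by
  have h0 : ∀ X ∈ F, 0 ∉ X := fun X hX h => by simpa using (hF.1 hX).1 h
  exact (weaklySep_iff (h0 X hX) (h0 Y hY)).1 (hF.2.1 X hX Y hY)

theorem mem_of_ws (hF : IsMaxWColl {X : Finset ℕ | X ⊆ Icc 1 n ∧ #X = m} F) (hZ : Z ⊆ Icc 1 n)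
    (hc : #Z = m) (hW : ∀ X ∈ F, WS X Z) : Z ∈ F := by
  have h0 : ∀ X ⊆ Icc 1 n, 0 ∉ X := fun X hX h => by simpa using hX h
  have hsub : ∀ X ∈ F, X ⊆ Icc 1 n := fun X hX => (hF.1 hX).1
  rw [hF.2.2 (insert Z F) _ _ (subset_insert Z F)]
  · exact mem_insert_self Z F
  · rw [coe_insert]
    exact Set.insert_subset ⟨hZ, hc⟩ hF.1
  · intro A hA B hB
    rcases mem_insert.1 hA with hAZ | hA <;> rcases mem_insert.1 hB with hBZ | hB
    · exact Or.inl (Or.inr (Or.inr (hAZ.trans hBZ.symm)))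
    · rw [hAZ]
      exact (weaklySep_iff (h0 _ hZ) (h0 _ (hsub _ hB))).2 (hW _ hB).symm
    · rw [hBZ]
      exact (weaklySep_iff (h0 _ (hsub _ hA)) (h0 _ hZ)).2 (hW _ hA)
    · exact hF.2.1 A hA B hB

theorem ico_mem (hF : IsMaxWColl {X : Finset ℕ | X ⊆ Icc 1 n ∧ #X = m} F) {a k : ℕ} (ha : 1 ≤ a)
    (hak : a + k ≤ n + 1) (hk : m ≤ k) : Ico a (a + k) ∈ F ∪ intervals n m := by
  rw [mem_union]
  rcases hk.eq_or_lt with rfl | hk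
  · refine Or.inl (hF.mem_of_ws (Ico_subset_Icc_one ha hak) (by simp) fun X hX => ?_)
    have := (hF.1 hX).2
    exact (ws_Ico (by omega)).symm
  · exact Or.inr (mem_intervals.2 ⟨a, k, ha, hk, hak, rfl⟩)

theorem sdiff_ico_mem (hF : IsMaxWColl {X : Finset ℕ | X ⊆ Icc 1 n ∧ #X = m} F) (hm : m ≤ n)
    {a k : ℕ} (ha : 1 ≤ a) (hak : a + k ≤ n + 1) (hk : n - m ≤ k) :
    Icc 1 n \ Ico a (a + k) ∈ F ∪ coIntervals n (n - m) := by
  rw [mem_union]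
  have hs := Ico_subset_Icc_one ha hak
  rcases hk.eq_or_lt with rfl | hk
  · refine Or.inl (hF.mem_of_ws sdiff_subset ?_ fun X hX => ?_)
    · rw [card_sdiff_of_subset hs, Nat.card_Ico, Nat.card_Icc]
      omega
    · have := (hF.1 hX).2
      exact (ws_sdiff_Ico (hF.1 hX).1 hs (by rw [Nat.card_Icc]; omega)).symm
  · exact Or.inr (mem_image_of_mem _ (mem_intervals.2 ⟨a, k, ha, hk, hak, rfl⟩))

/-- A maximal collection in the Grassmannian becomes maximal among all subsets of `[1, n]` once
the larger intervals and the smaller complements of intervals are added. -/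
theorem maxWS (hm : m ≤ n) (hF : IsMaxWColl {X : Finset ℕ | X ⊆ Icc 1 n ∧ #X = m} F) :
    MaxWS (Icc 1 n)
      ((F ∪ intervals n m ∪ coIntervals n (n - m) : Finset (Finset ℕ)) : Set (Finset ℕ)) := by
  set E := F ∪ intervals n m ∪ coIntervals n (n - m)
  have hE : ∀ X, X ∈ E ↔ X ∈ F ∨ X ∈ intervals n m ∨ X ∈ coIntervals n (n - m) := fun X => by
    rw [mem_union, mem_union, or_assoc]
  have hIE : ∀ X ∈ F ∪ intervals n m, X ∈ E := fun X hX => mem_union_left _ hX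
  have hJE : ∀ X ∈ F ∪ coIntervals n (n - m), X ∈ E := fun X hX =>
    (hE X).2 ((mem_union.1 hX).imp_right Or.inr)
  have hEsub : ∀ X ∈ E, X ⊆ Icc 1 n := fun X hX =>
    ((hE X).1 hX).elim (fun h => (hF.1 h).1) fun h =>
      h.elim subset_of_mem_intervals subset_of_mem_coIntervals
  have hFc : ∀ X ∈ F, #X = m := fun X hX => (hF.1 hX).2
  have hIc : ∀ X ∈ intervals n m, m < #X := fun X => lt_card_of_mem_intervals
  have hJc : ∀ X ∈ coIntervals n (n - m), #X < m := fun X hX => by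
    have := card_add_lt_of_mem_coIntervals hX
    omega
  refine ⟨hEsub, fun X hX Y hY => ?_, fun Z hZ hW => ?_⟩
  · have hXs := hEsub X hX
    have hYs := hEsub Y hY
    have hI : ∀ {X Y}, X ∈ intervals n m → #Y ≤ m → WS X Y := fun hX hY =>
      ws_of_mem_intervals hX (hY.trans (hIc _ hX).le)
    have hJ : ∀ {X Y}, X ∈ coIntervals n (n - m) → Y ⊆ Icc 1 n → m ≤ #Y → WS X Y :=
      fun hX hYs hY => ws_of_mem_coIntervals hX hYs ((hJc _ hX).le.trans hY)
    rcases (hE X).1 hX with hX | hX | hX <;> rcases (hE Y).1 hY with hY | hY | hY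
    · exact hF.ws hX hY
    · exact (hI hY (hFc X hX).le).symm
    · exact (hJ hY hXs (hFc X hX).ge).symm
    · exact hI hX (hFc Y hY).le
    · exact (le_total #Y #X).elim (ws_of_mem_intervals hX) fun h => (ws_of_mem_intervals hY h).symm
    · exact hI hX (hJc Y hY).le
    · exact hJ hX hYs (hFc Y hY).ge
    · exact hJ hX hYs (hIc Y hY).le
    · exact (le_total #X #Y).elim (ws_of_mem_coIntervals hX hYs) fun h =>
        (ws_of_mem_coIntervals hY hXs h).symm
  · have hc := card_sdiff_add_card_eq_card hZ
    rw [Nat.card_Icc, Nat.add_sub_cancel] at hc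
    rcases lt_trichotomy #Z m with hlt | heq | hlt
    · obtain ⟨a, ha, hak, he⟩ := eq_Ico_of_ws (sdiff_subset (s := Icc 1 n) (t := Z))
        (card_pos.1 (by omega)) fun a ha hak => by
          have hs := Ico_subset_Icc_one ha hak
          have := (hW _ (hJE _ (hF.sdiff_ico_mem hm ha hak (by omega)))).compl sdiff_subset hZ
          rwa [Finset.sdiff_sdiff_eq_self hs] at this
      rw [← Finset.sdiff_sdiff_eq_self hZ, he]
      exact hJE _ (hF.sdiff_ico_mem hm ha hak (by omega))
    · exact (hE Z).2 (Or.inl (hF.mem_of_ws hZ heq fun X hX => hW X ((hE X).2 (Or.inl hX))))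
    · obtain ⟨a, ha, hak, he⟩ := eq_Ico_of_ws hZ (card_pos.1 (by omega)) fun a ha hak =>
        hW _ (hIE _ (hF.ico_mem ha hak (by omega)))
      rw [he]
      exact hIE _ (hF.ico_mem ha hak hlt.le)

theorem card_eq (hm : m ≤ n) (hF : IsMaxWColl {X : Finset ℕ | X ⊆ Icc 1 n ∧ #X = m} F) :
    #F = m * (n - m) + 1 := by
  have hIc : ∀ X ∈ intervals n m, m < #X := fun X => lt_card_of_mem_intervals
  have hJc : ∀ X ∈ coIntervals n (n - m), #X < m := fun X hX => by
    have := card_add_lt_of_mem_coIntervals hX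
    omega
  have h1 := (hF.maxWS hm).card_eq
  rw [card_union_of_disjoint, card_union_of_disjoint, card_intervals, card_coIntervals,
    Nat.sub_sub_self hm, Nat.card_Icc, Nat.add_sub_cancel] at h1
  · have h2 := choose_two_add (n - m) m
    rw [Nat.sub_add_cancel hm] at h2
    rw [mul_comm]
    omega
  · refine disjoint_left.2 fun X hX hX' => ?_
    exact (hIc X hX').ne' (hF.1 hX).2
  · refine disjoint_left.2 fun X hX hX' => ?_
    rcases mem_union.1 hX with hX | hX
    · exact (hJc X hX').ne (hF.1 hX).2
    · exact (hJc X hX').asymm (hIc X hX)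

end IsMaxWColl

/-- for `0 ≤ m ≤ n`, the discrete Grassmannian `Δ_n^m` is w-pure,
with w-rank `m(n−m) + 1`. -/
theorem grassmannian_w_pure (n m : ℕ) (hn : 1 ≤ n) (hm : m ≤ n) :
    WPure {X : Finset ℕ | X ⊆ Finset.Icc 1 n ∧ X.card = m} ∧
    ∀ F : Finset (Finset ℕ),
      IsMaxWColl {X : Finset ℕ | X ⊆ Finset.Icc 1 n ∧ X.card = m} F →
      F.card = m * (n - m) + 1 :=
  ⟨fun _ _ hF hG => (hF.card_eq hm).trans (hG.card_eq hm).symm, fun _ hF => hF.card_eq hm⟩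
end

section
/- Let F be a maximal w-collection in 2^[n]. Suppose that for some i < j < k in [n] and some A ⊆ [n] ∖ {i, j, k}, F contains the four sets A∪{i}, A∪{k}, A∪{i,j}, A∪{j,k}, and contains one set B of the pair {A∪{j}, A∪{i,k}}. Then (F ∖ {B}) ∪ {B′}, where B′ is the other set of the pair {A∪{j}, A∪{i,k}}, is also a maximal w-collection in 2^[n]. -/
open Finset

/-- `X \ D` lies in an interval that is disjoint from `D \ X`. -/
def IntervalSep (X D : Finset ℕ) : Prop :=
  ∃ p q, ∀ x, (x ∈ X → x ∉ D → p ≤ x ∧ x < q) ∧ (x ∈ D → x ∉ X → x < p ∨ q ≤ x)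

theorem setLT_iff_s10 (X Y : Finset ℕ) :
    SetLT X Y ↔ Y.Nonempty ∧ (∀ y ∈ Y, 0 < y) ∧ ∀ x ∈ X, ∀ y ∈ Y, x < y := by
  unfold SetLT max0 min0
  by_cases hY : Y.Nonempty
  · by_cases hX : X.Nonempty
    · simp only [hX, hY, dif_pos, Finset.max'_lt_iff, Finset.lt_min'_iff, true_and]
      exact ⟨fun h => ⟨fun y hy => (h y hy _ (X.max'_mem hX)).pos,
        fun x hx y hy => h y hy x hx⟩, fun h y hy x hx => h.2 x hx y hy⟩
    · simp [hY, Finset.not_nonempty_iff_eq_empty.1 hX, Finset.lt_min'_iff]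
  · simp [hY]

theorem intervalSep_of_forall (X D : Finset ℕ)
    (h : ∀ x y z, x < y → y < z → x ∈ X → x ∉ D → y ∈ D → y ∉ X → z ∈ X → z ∉ D → False) :
    IntervalSep X D := by
  by_cases hX : (X \ D).Nonempty
  · have hp := (X \ D).min'_mem hX
    have hq := (X \ D).max'_mem hX
    refine ⟨(X \ D).min' hX, (X \ D).max' hX + 1, fun x => ⟨fun h1 h2 => ?_, fun h1 h2 => ?_⟩⟩
    · have hx : x ∈ X \ D := by simp [h1, h2]
      exact ⟨(X \ D).min'_le x hx, Nat.lt_succ_of_le ((X \ D).le_max' x hx)⟩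
    · generalize (X \ D).min' hX = p at *
      generalize (X \ D).max' hX = q at *
      rw [Finset.mem_sdiff] at hp hq
      by_contra hc
      have h3 : p ≠ x := by rintro rfl; exact h2 hp.1
      have h4 : q ≠ x := by rintro rfl; exact h2 hq.1
      exact h p x q (by omega) (by omega) hp.1 hp.2 h1 h2 hq.1 hq.2
  · rw [Finset.not_nonempty_iff_eq_empty, Finset.sdiff_eq_empty_iff_subset] at hX
    exact ⟨0, 0, fun x => ⟨fun h1 h2 => absurd (hX h1) h2, fun _ _ => Or.inr x.zero_le⟩⟩

theorem LessDot.intervalSep_left {X D : Finset ℕ} (h : LessDot X D) : IntervalSep X D := by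
  apply intervalSep_of_forall
  intro x y z _ hyz _ _ hy hy' hz hz'
  have := ((setLT_iff_s10 _ _).1 h).2.2 z (by simp [*]) y (by simp [*])
  omega

theorem LessDot.intervalSep_right {X D : Finset ℕ} (h : LessDot X D) : IntervalSep D X := by
  apply intervalSep_of_forall
  intro x y z hxy _ hx hx' hy hy' _ _
  have := ((setLT_iff_s10 _ _).1 h).2.2 y (by simp [*]) x (by simp [*])
  omega

theorem Splits.intervalSep {X D : Finset ℕ} (h : Splits X D) : IntervalSep X D := by
  obtain ⟨-, B, C, -, -, hu, hB, hC⟩ := h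
  rw [setLT_iff_s10] at hB hC
  apply intervalSep_of_forall
  intro x y z hxy hyz hx hx' hy hy' hz hz'
  have hyu : y ∈ B ∪ C := by rw [hu]; simp [*]
  rcases Finset.mem_union.1 hyu with hy | hy
  · have := hB.2.2 y hy x (by simp [*])
    omega
  · have := hC.2.2 z (by simp [*]) y hy
    omega

theorem WeaklySep.symm {X D : Finset ℕ} (h : WeaklySep X D) : WeaklySep D X := by
  unfold WeaklySep StronglySep at *
  tauto

theorem weaklySep_of_intervalSep {X D : Finset ℕ} (hX : ∀ x ∈ X, 0 < x) (hD : ∀ x ∈ D, 0 < x)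
    (hc : D.card ≤ X.card) (h : IntervalSep X D) : WeaklySep X D := by
  obtain ⟨p, q, h⟩ := h
  by_cases hXD : X ⊆ D
  · exact Or.inl (Or.inr (Or.inr (Finset.eq_of_subset_of_card_le hXD hc)))
  have hne : (X \ D).Nonempty := Finset.sdiff_nonempty.2 hXD
  unfold WeaklySep StronglySep LessDot Splits
  simp only [setLT_iff_s10]
  by_cases hl : ((D \ X).filter (· < p)).Nonempty
  · by_cases hr : ((D \ X).filter (q ≤ ·)).Nonempty
    · refine Or.inr (Or.inl ⟨⟨hne, _, _, hl, hr, ?_, ⟨hne, ?_, ?_⟩, hr, ?_, ?_⟩, hc⟩) <;>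
        grind
    · rw [Finset.not_nonempty_iff_eq_empty, Finset.filter_eq_empty_iff] at hr
      exact Or.inl (Or.inr (Or.inl ⟨hne, by grind, by grind⟩))
  · rw [Finset.not_nonempty_iff_eq_empty, Finset.filter_eq_empty_iff] at hl
    by_cases hDX : (D \ X).Nonempty
    · exact Or.inl (Or.inl ⟨hDX, by grind, by grind⟩)
    · exact Or.inl (Or.inr (Or.inl ⟨hne, by grind, by grind⟩))

theorem weaklySep_iff_s10 {X D : Finset ℕ} (hX : ∀ x ∈ X, 0 < x) (hD : ∀ x ∈ D, 0 < x) :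
    WeaklySep X D ↔ D.card ≤ X.card ∧ IntervalSep X D ∨ X.card ≤ D.card ∧ IntervalSep D X := by
  constructor
  · rintro ((h | h | rfl) | h | h)
    · exact (le_total D.card X.card).imp (⟨·, h.intervalSep_left⟩) (⟨·, h.intervalSep_right⟩)
    · exact (le_total D.card X.card).imp (⟨·, h.intervalSep_right⟩) (⟨·, h.intervalSep_left⟩)
    · exact Or.inl ⟨le_rfl, 0, 0, by simp⟩
    · exact Or.inl ⟨h.2, h.1.intervalSep⟩
    · exact Or.inr ⟨h.2, h.1.intervalSep⟩
  · rintro (⟨hc, h⟩ | ⟨hc, h⟩)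
    · exact weaklySep_of_intervalSep hX hD hc h
    · exact (weaklySep_of_intervalSep hD hX hc h).symm

theorem exists_mem_notMem_of_card_le {X D : Finset ℕ} (hc : D.card ≤ X.card) (hne : D ≠ X) :
    ∃ x ∈ X, x ∉ D := by
  by_contra! h
  exact hne (Finset.eq_of_subset_of_card_le h hc).symm

theorem intervalSep_flip_up_of_card_le {D A : Finset ℕ} {i j k : ℕ} (hij : i < j) (hjk : j < k)
    (hne : D ≠ insert j A) (hD : D.card ≤ A.card + 1) (hjA : j ∉ A)
    (h1 : D.card ≤ A.card + 1 ∧ IntervalSep (insert i A) D ∨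
      A.card + 1 ≤ D.card ∧ IntervalSep D (insert i A))
    (h2 : D.card ≤ A.card + 1 ∧ IntervalSep (insert k A) D ∨
      A.card + 1 ≤ D.card ∧ IntervalSep D (insert k A))
    (h5 : D.card ≤ A.card + 1 ∧ IntervalSep (insert j A) D ∨
      A.card + 1 ≤ D.card ∧ IntervalSep D (insert j A))
    (h3 : IntervalSep (insert i (insert j A)) D)
    (h4 : IntervalSep (insert j (insert k A)) D) :
    IntervalSep (insert i (insert k A)) D := by
  obtain ⟨u, hu, hu'⟩ := exists_mem_notMem_of_card_le (X := insert j A) (D := D) (by simp [*]) hne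
  have hv : A.card + 1 ≤ D.card → ∃ v ∈ D, v ∉ insert j A := fun h =>
    exists_mem_notMem_of_card_le (by simp [*]) hne.symm
  apply intervalSep_of_forall
  intro x y z hxy hyz hx hx' hy hy' hz hz'
  obtain ⟨p3, q3, h3⟩ := h3
  obtain ⟨p4, q4, h4⟩ := h4
  simp only [Finset.mem_insert] at *
  rcases h1 with ⟨c1, p1, q1, h1⟩ | ⟨c1, p1, q1, h1⟩ <;>
  rcases h2 with ⟨c2, p2, q2, h2⟩ | ⟨c2, p2, q2, h2⟩ <;>
  rcases h5 with ⟨c5, p5, q5, h5⟩ | ⟨c5, p5, q5, h5⟩ <;>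
  grind

theorem exists_of_not_intervalSep {X D : Finset ℕ} (h : ¬IntervalSep X D) :
    ∃ x y z, x < y ∧ y < z ∧ x ∈ X ∧ x ∉ D ∧ y ∈ D ∧ y ∉ X ∧ z ∈ X ∧ z ∉ D := by
  by_contra hc
  exact h (intervalSep_of_forall X D fun x y z h1 h2 h3 h4 h5 h6 h7 h8 =>
    hc ⟨x, y, z, h1, h2, h3, h4, h5, h6, h7, h8⟩)

theorem separated_flip_up_of_le_card {D A : Finset ℕ} {i j k : ℕ} (hij : i < j) (hjk : j < k)
    (hD : A.card + 2 ≤ D.card)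
    (h1 : IntervalSep D (insert i A))
    (h2 : IntervalSep D (insert k A))
    (h5 : IntervalSep D (insert j A))
    (h3 : D.card ≤ A.card + 2 ∧ IntervalSep (insert i (insert j A)) D ∨
      A.card + 2 ≤ D.card ∧ IntervalSep D (insert i (insert j A)))
    (h4 : D.card ≤ A.card + 2 ∧ IntervalSep (insert j (insert k A)) D ∨
      A.card + 2 ≤ D.card ∧ IntervalSep D (insert j (insert k A))) :
    D.card ≤ A.card + 2 ∧ IntervalSep (insert i (insert k A)) D ∨
      A.card + 2 ≤ D.card ∧ IntervalSep D (insert i (insert k A)) := by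
  by_contra! hc
  obtain ⟨x, y, z, h⟩ := exists_of_not_intervalSep (hc.2 hD)
  have hc' := fun h => exists_of_not_intervalSep (hc.1 h)
  clear hc
  obtain ⟨p1, q1, h1⟩ := h1
  obtain ⟨p2, q2, h2⟩ := h2
  obtain ⟨p5, q5, h5⟩ := h5
  simp only [Finset.mem_insert] at *
  rcases h3 with ⟨c3, p3, q3, h3⟩ | ⟨c3, p3, q3, h3⟩ <;>
  rcases h4 with ⟨c4, p4, q4, h4⟩ | ⟨c4, p4, q4, h4⟩ <;>
  grind

theorem intervalSep_flip_down_of_le_card {D A : Finset ℕ} {i j k : ℕ} (hij : i < j) (hjk : j < k)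
    (hne : D ≠ insert i (insert k A)) (hD : A.card + 2 ≤ D.card)
    (hiA : i ∉ A) (hjA : j ∉ A) (hkA : k ∉ A)
    (h1 : IntervalSep D (insert i A))
    (h2 : IntervalSep D (insert k A))
    (h3 : D.card ≤ A.card + 2 ∧ IntervalSep (insert i (insert j A)) D ∨
      A.card + 2 ≤ D.card ∧ IntervalSep D (insert i (insert j A)))
    (h4 : D.card ≤ A.card + 2 ∧ IntervalSep (insert j (insert k A)) D ∨
      A.card + 2 ≤ D.card ∧ IntervalSep D (insert j (insert k A)))
    (h5 : D.card ≤ A.card + 2 ∧ IntervalSep (insert i (insert k A)) D ∨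
      A.card + 2 ≤ D.card ∧ IntervalSep D (insert i (insert k A))) :
    IntervalSep D (insert j A) := by
  have hik : i ∉ insert k A := by simp [hiA]; omega
  have hc : (insert i (insert k A)).card = A.card + 2 := by simp [*]
  obtain ⟨u, hu, hu'⟩ := exists_mem_notMem_of_card_le (hc.trans_le hD) hne.symm
  have hv : D.card ≤ A.card + 2 → ∃ v ∈ insert i (insert k A), v ∉ D := fun h =>
    exists_mem_notMem_of_card_le (by omega) hne
  apply intervalSep_of_forall
  intro x y z hxy hyz hx hx' hy hy' hz hz'
  obtain ⟨p1, q1, h1⟩ := h1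
  obtain ⟨p2, q2, h2⟩ := h2
  simp only [Finset.mem_insert] at *
  rcases h3 with ⟨c3, p3, q3, h3⟩ | ⟨c3, p3, q3, h3⟩ <;>
  rcases h4 with ⟨c4, p4, q4, h4⟩ | ⟨c4, p4, q4, h4⟩ <;>
  rcases h5 with ⟨c5, p5, q5, h5⟩ | ⟨c5, p5, q5, h5⟩ <;>
  grind

theorem separated_flip_down_of_card_le {D A : Finset ℕ} {i j k : ℕ} (hij : i < j) (hjk : j < k)
    (hD : D.card ≤ A.card + 1)
    (h1 : D.card ≤ A.card + 1 ∧ IntervalSep (insert i A) D ∨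
      A.card + 1 ≤ D.card ∧ IntervalSep D (insert i A))
    (h2 : D.card ≤ A.card + 1 ∧ IntervalSep (insert k A) D ∨
      A.card + 1 ≤ D.card ∧ IntervalSep D (insert k A))
    (h3 : IntervalSep (insert i (insert j A)) D)
    (h4 : IntervalSep (insert j (insert k A)) D)
    (h5 : IntervalSep (insert i (insert k A)) D) :
    D.card ≤ A.card + 1 ∧ IntervalSep (insert j A) D ∨
      A.card + 1 ≤ D.card ∧ IntervalSep D (insert j A) := by
  by_contra! hc
  obtain ⟨x, y, z, h⟩ := exists_of_not_intervalSep (hc.1 hD)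
  have hc' := fun h => exists_of_not_intervalSep (hc.2 h)
  clear hc
  obtain ⟨p3, q3, h3⟩ := h3
  obtain ⟨p4, q4, h4⟩ := h4
  obtain ⟨p5, q5, h5⟩ := h5
  simp only [Finset.mem_insert] at *
  rcases h1 with ⟨c1, p1, q1, h1⟩ | ⟨c1, p1, q1, h1⟩ <;>
  rcases h2 with ⟨c2, p2, q2, h2⟩ | ⟨c2, p2, q2, h2⟩ <;>
  grind

/-- The four sets that witness a weak flip. -/
def flipWitnesses (A : Finset ℕ) (i j k : ℕ) : Finset (Finset ℕ) :=
  {insert i A, insert k A, insert i (insert j A), insert j (insert k A)}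

theorem card_insert_insert_eq {A : Finset ℕ} {a b : ℕ} (hab : a ≠ b) (ha : a ∉ A) (hb : b ∉ A) :
    (insert a (insert b A)).card = A.card + 2 := by
  simp [*]

theorem weaklySep_flip_up {D A : Finset ℕ} {i j k : ℕ} (h0 : 0 < i) (hij : i < j) (hjk : j < k)
    (hA : ∀ x ∈ A, 0 < x) (hD : ∀ x ∈ D, 0 < x) (hiA : i ∉ A) (hjA : j ∉ A) (hkA : k ∉ A)
    (hW : ∀ W ∈ flipWitnesses A i j k, WeaklySep W D)
    (hne : D ≠ insert j A) (h : WeaklySep (insert j A) D) :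
    WeaklySep (insert i (insert k A)) D := by
  simp only [flipWitnesses, Finset.forall_mem_insert, Finset.mem_singleton, forall_eq] at hW
  obtain ⟨h1, h2, h3, h4⟩ := hW
  rw [weaklySep_iff_s10 (by grind) hD] at h h1 h2 h3 h4 ⊢
  rw [card_insert_insert_eq (by omega) ‹_› ‹_›] at h3 h4 ⊢
  rw [Finset.card_insert_of_notMem ‹_›] at h h1 h2
  rcases le_or_gt D.card (A.card + 1) with hc | hc
  · exact Or.inl ⟨by omega, intervalSep_flip_up_of_card_le hij hjk hne hc hjA h1 h2 h
      (by grind) (by grind)⟩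
  · exact separated_flip_up_of_le_card hij hjk hc (by grind) (by grind) (by grind) h3 h4

theorem weaklySep_flip_down {D A : Finset ℕ} {i j k : ℕ} (h0 : 0 < i) (hij : i < j) (hjk : j < k)
    (hA : ∀ x ∈ A, 0 < x) (hD : ∀ x ∈ D, 0 < x) (hiA : i ∉ A) (hjA : j ∉ A) (hkA : k ∉ A)
    (hW : ∀ W ∈ flipWitnesses A i j k, WeaklySep W D)
    (hne : D ≠ insert i (insert k A)) (h : WeaklySep (insert i (insert k A)) D) :
    WeaklySep (insert j A) D := by
  simp only [flipWitnesses, Finset.forall_mem_insert, Finset.mem_singleton, forall_eq] at hW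
  obtain ⟨h1, h2, h3, h4⟩ := hW
  rw [weaklySep_iff_s10 (by grind) hD] at h h1 h2 h3 h4 ⊢
  rw [card_insert_insert_eq (by omega) ‹_› ‹_›] at h h3 h4
  rw [Finset.card_insert_of_notMem ‹_›] at h1 h2 ⊢
  rcases le_or_gt D.card (A.card + 1) with hc | hc
  · exact separated_flip_down_of_card_le hij hjk hc h1 h2 (by grind) (by grind) (by grind)
  · exact Or.inr ⟨by omega, intervalSep_flip_down_of_le_card hij hjk hne hc hiA hjA hkA
      (by grind) (by grind) h3 h4 h⟩

theorem not_weaklySep_flip_pair {A : Finset ℕ} {i j k : ℕ} (h0 : 0 < i) (hij : i < j) (hjk : j < k)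
    (hA : ∀ x ∈ A, 0 < x) (hiA : i ∉ A) (hjA : j ∉ A) (hkA : k ∉ A) :
    ¬WeaklySep (insert i (insert k A)) (insert j A) := by
  rw [weaklySep_iff_s10 (by grind) (by grind), card_insert_insert_eq (by omega) hiA hkA,
    Finset.card_insert_of_notMem hjA]
  rintro (⟨-, p, q, h⟩ | ⟨hc, -⟩)
  · have := h i
    have := h j
    have := h k
    grind
  · omega

theorem WeaklySep.refl (X : Finset ℕ) : WeaklySep X X := Or.inl (Or.inr (Or.inr rfl))

theorem IsMaxWColl.mem_of_forall {S : Set (Finset ℕ)} {F : Finset (Finset ℕ)}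
    (hF : IsMaxWColl S F) {X : Finset ℕ} (hX : X ∈ S) (h : ∀ Y ∈ F, WeaklySep X Y) : X ∈ F := by
  have hG := hF.2.2 (insert X F) (by simpa [Set.insert_subset_iff] using ⟨hX, hF.1⟩) ?_
    (Finset.subset_insert X F)
  · rw [hG]
    exact Finset.mem_insert_self X F
  · intro Y hY Z hZ
    rw [Finset.mem_insert] at hY hZ
    rcases hY with rfl | hY <;> rcases hZ with rfl | hZ
    · exact WeaklySep.refl _
    · exact h Z hZ
    · exact (h Y hY).symm
    · exact hF.2.1 Y hY Z hZ

/-- Exchanging two non-separated sets preserves maximality if, in the presence of the witnesses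
`W`, being separated from one of them is the same as being separated from the other. -/
theorem IsMaxWColl.exchange {S : Set (Finset ℕ)} {F W : Finset (Finset ℕ)} {B B' : Finset ℕ}
    (hF : IsMaxWColl S F) (hB : B ∈ F) (hB' : B' ∈ S) (hWF : W ⊆ F.erase B)
    (hBB' : ¬WeaklySep B B')
    (h : ∀ D ∈ S, (∀ X ∈ W, WeaklySep X D) → D ≠ B → WeaklySep B D → WeaklySep B' D)
    (h' : ∀ D ∈ S, (∀ X ∈ W, WeaklySep X D) → D ≠ B' → WeaklySep B' D → WeaklySep B D) :
    IsMaxWColl S (insert B' (F.erase B)) := by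
  have hWF' : ∀ X ∈ W, X ∈ F := fun X hX => Finset.mem_of_mem_erase (hWF hX)
  have hsep : ∀ D ∈ F.erase B, WeaklySep B' D := fun D hD => by
    obtain ⟨hne, hD⟩ := Finset.mem_erase.1 hD
    exact h D (hF.1 hD) (fun X hX => hF.2.1 X (hWF' X hX) D hD) hne (hF.2.1 B hB D hD)
  refine ⟨?_, ?_, ?_⟩
  · intro X hX
    rcases Finset.mem_insert.1 (Finset.mem_coe.1 hX) with rfl | hX
    · exact hB'
    · exact hF.1 (Finset.mem_of_mem_erase hX)
  · intro Y hY Z hZ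
    rw [Finset.mem_insert] at hY hZ
    rcases hY with rfl | hY <;> rcases hZ with rfl | hZ
    · exact WeaklySep.refl _
    · exact hsep Z hZ
    · exact (hsep Y hY).symm
    · exact hF.2.1 Y (Finset.mem_of_mem_erase hY) Z (Finset.mem_of_mem_erase hZ)
  · intro G hGS hG hFG
    refine hFG.antisymm fun D hD => ?_
    rw [Finset.mem_insert, or_iff_not_imp_left]
    intro hne
    have hB'G : B' ∈ G := hFG (Finset.mem_insert_self _ _)
    have hFG' : ∀ X ∈ F.erase B, X ∈ G := fun X hX => hFG (Finset.mem_insert_of_mem hX)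
    have hDB : D ≠ B := by
      rintro rfl
      exact hBB' (hG D hD B' hB'G)
    refine Finset.mem_erase.2 ⟨hDB, hF.mem_of_forall (hGS hD) fun Y hY => ?_⟩
    by_cases hYB : Y = B
    · subst hYB
      exact (h' D (hGS hD) (fun X hX => hG X (hFG' X (hWF hX)) D hD) hne (hG B' hB'G D hD)).symm
    · exact hG D hD Y (hFG' Y (Finset.mem_erase.2 ⟨hYB, hY⟩))

/-- a weak flip ("in the presence of four witnesses") applied to a
maximal w-collection in `2^[n]` yields a maximal w-collection in `2^[n]`. -/
theorem weak_flip_max_w_collection (n : ℕ) (hn : 1 ≤ n) (F : Finset (Finset ℕ))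
    (hF : IsMaxWColl {X : Finset ℕ | X ⊆ Finset.Icc 1 n} F)
    (i j k : ℕ) (hi : i ∈ Finset.Icc 1 n) (hj : j ∈ Finset.Icc 1 n)
    (hk : k ∈ Finset.Icc 1 n) (hij : i < j) (hjk : j < k)
    (A : Finset ℕ) (hA : A ⊆ Finset.Icc 1 n)
    (hiA : i ∉ A) (hjA : j ∉ A) (hkA : k ∉ A)
    (h1 : insert i A ∈ F) (h2 : insert k A ∈ F)
    (h3 : insert i (insert j A) ∈ F) (h4 : insert j (insert k A) ∈ F)
    (B B' : Finset ℕ)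
    (hBB' : (B = insert j A ∧ B' = insert i (insert k A)) ∨
            (B = insert i (insert k A) ∧ B' = insert j A))
    (hB : B ∈ F) :
    IsMaxWColl {X : Finset ℕ | X ⊆ Finset.Icc 1 n} (insert B' (F.erase B)) := by
  have h0 : 0 < i := (Finset.mem_Icc.1 hi).1
  have hpos : ∀ D ∈ {X : Finset ℕ | X ⊆ Finset.Icc 1 n}, ∀ x ∈ D, 0 < x :=
    fun D hD x hx => (Finset.mem_Icc.1 (hD hx)).1
  have hnot := not_weaklySep_flip_pair h0 hij hjk (hpos A hA) hiA hjA hkA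
  have hWF : flipWitnesses A i j k ⊆ F.erase B := by
    have hne : B ∉ flipWitnesses A i j k := by
      simp only [flipWitnesses, Finset.mem_insert, Finset.mem_singleton, Finset.ext_iff]
      grind
    intro X hX
    refine Finset.mem_erase.2 ⟨fun h => hne (h ▸ hX), ?_⟩
    simp only [flipWitnesses, Finset.mem_insert, Finset.mem_singleton] at hX
    rcases hX with rfl | rfl | rfl | rfl <;> assumption
  have hup := fun D hD => weaklySep_flip_up (D := D) h0 hij hjk (hpos A hA) (hpos D hD) hiA hjA hkA
  have hdown := fun D hD =>
    weaklySep_flip_down (D := D) h0 hij hjk (hpos A hA) (hpos D hD) hiA hjA hkA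
  rcases hBB' with ⟨rfl, rfl⟩ | ⟨rfl, rfl⟩
  · exact hF.exchange hB (by simp [Finset.insert_subset_iff, *]) hWF (fun h => hnot h.symm) hup hdown
  · exact hF.exchange hB (by simp [Finset.insert_subset_iff, *]) hWF hnot hdown hup
end
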